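/- Let K be a subfield of ℂ, q an indeterminate over K, and ξ a diagonal K[q,q^{-1}]-point of M_q such that η(ξ) ∈ M(N,K) has pairwise different eigenvalues. Then the image of the co-orbit map β^ξ_{K(q)} : O_{K(q)}(M_q) → O_{K(q)}(GL_q) coincides with O_{K(q)}(D\GL_q), the subalgebra of coinvariants of the left coaction of the diagonal quantum subgroup. -/

import Mathlib

open TensorProduct

noncomputable section

/-- Number of inversions (the length) of a permutation of `Fin t`. -/
def invCount {t : ℕ} (σ : Equiv.Perm (Fin t)) : ℕ :=
  (Finset.univ.filter fun p : Fin t × Fin t => p.1 < p.2 ∧ σ p.2 < σ p.1).card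

/-- The principal quantum minor `[I|I]` of the matrix of generators `x`. -/
def qMinor {A : Type} [CommRing A] {M : Type} [Ring M] [Algebra A M] {N : ℕ}
    (q : A) (x : Fin N → Fin N → M) (I : Finset (Fin N)) : M :=
  ∑ σ : Equiv.Perm (Fin I.card),
    ((-q) ^ invCount σ) •
      ((List.finRange I.card).map fun k =>
        x ((I.orderIsoOfFin rfl) k).1 ((I.orderIsoOfFin rfl) (σ k)).1).prod

/-- The quantum determinant. -/
def qdet {A : Type} [CommRing A] {M : Type} [Ring M] [Algebra A M] {N : ℕ}
    (q : A) (x : Fin N → Fin N → M) : M :=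
  qMinor q x Finset.univ

/-- `w(I)`: the sum of the elements of `I` (with `{1, …, N}` indexing). -/
def wtSet {N : ℕ} (I : Finset (Fin N)) : ℕ := ∑ j ∈ I, (j.1 + 1)

/-- The weighted sum `τ_i` of principal quantum minors of size `i`. -/
def tauCoinv {A : Type} [CommRing A] {M : Type} [Ring M] [Algebra A M] {N : ℕ}
    (q qinv : A) (x : Fin N → Fin N → M) (i : ℕ) : M :=
  ∑ I ∈ Finset.univ.filter (fun I : Finset (Fin N) => I.card = i),
    qinv ^ (2 * wtSet I) • qMinor q x I

/-- The sum `σ_i` of all principal quantum minors of size `i`. -/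
def sigmaCoinv {A : Type} [CommRing A] {M : Type} [Ring M] [Algebra A M] {N : ℕ}
    (q : A) (x : Fin N → Fin N → M) (i : ℕ) : M :=
  ∑ I ∈ Finset.univ.filter (fun I : Finset (Fin N) => I.card = i), qMinor q x I

/-- The right adjoint coaction `β(h) = Σ h₂ ⊗ S(h₁)h₃`. -/
def adjBeta {A : Type} [CommRing A] {M G : Type} [Ring M] [Algebra A M] [Ring G] [Algebra A G]
    (ΔM : M →ₐ[A] M ⊗[A] M) (ι : M →ₐ[A] G) (St : G →ₗ[A] G) : M →ₗ[A] M ⊗[A] G :=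
  TensorProduct.map LinearMap.id (LinearMap.mul' A G) ∘ₗ
  (TensorProduct.assoc A M G G).toLinearMap ∘ₗ
  TensorProduct.map
    ((TensorProduct.comm A G M).toLinearMap ∘ₗ
      TensorProduct.map (St ∘ₗ ι.toLinearMap) LinearMap.id)
    ι.toLinearMap ∘ₗ
  TensorProduct.map ΔM.toLinearMap LinearMap.id ∘ₗ ΔM.toLinearMap

/-- The right coaction `α(h) = Σ h₂ ⊗ h₃S(h₁)`. -/
def adjAlpha {A : Type} [CommRing A] {M G : Type} [Ring M] [Algebra A M] [Ring G] [Algebra A G]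
    (ΔM : M →ₐ[A] M ⊗[A] M) (ι : M →ₐ[A] G) (St : G →ₗ[A] G) : M →ₗ[A] M ⊗[A] G :=
  TensorProduct.map LinearMap.id (LinearMap.mul' A G) ∘ₗ
  TensorProduct.map LinearMap.id (TensorProduct.comm A G G).toLinearMap ∘ₗ
  (TensorProduct.assoc A M G G).toLinearMap ∘ₗ
  TensorProduct.map
    ((TensorProduct.comm A G M).toLinearMap ∘ₗ
      TensorProduct.map (St ∘ₗ ι.toLinearMap) LinearMap.id)
    ι.toLinearMap ∘ₗ
  TensorProduct.map ΔM.toLinearMap LinearMap.id ∘ₗ ΔM.toLinearMap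

/-- The co-orbit map associated to a point `e = ev_ξ` and a coaction `b`. -/
def coorbit {A : Type} [CommRing A] {M G : Type} [Ring M] [Algebra A M] [Ring G] [Algebra A G]
    (e : M →ₐ[A] A) (b : M →ₗ[A] M ⊗[A] G) : M →ₗ[A] G :=
  (TensorProduct.lid A G).toLinearMap ∘ₗ TensorProduct.map e.toLinearMap LinearMap.id ∘ₗ b

/-- The left coaction `λ_D = (π_D ⊗ id) ∘ Δ` of a quotient Hopf algebra. -/
def leftCoact {A : Type} [CommRing A] {G D : Type} [Ring G] [Algebra A G]
    [CommRing D] [Algebra A D]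
    (πD : G →ₐ[A] D) (ΔG : G →ₐ[A] G ⊗[A] G) : G →ₗ[A] D ⊗[A] G :=
  TensorProduct.map πD.toLinearMap LinearMap.id ∘ₗ ΔG.toLinearMap

/-- Coinvariants of the left coaction `λ_D`. -/
def dCoinv {A : Type} [CommRing A] {G D : Type} [Ring G] [Algebra A G]
    [CommRing D] [Algebra A D]
    (πD : G →ₐ[A] D) (ΔG : G →ₐ[A] G ⊗[A] G) : Set G :=
  {f : G | leftCoact πD ΔG f = (1 : D) ⊗ₜ[A] f}

/-- The right coaction `ρ_D = (id ⊗ π_D) ∘ Δ`. -/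
def rightCoact {A : Type} [CommRing A] {G D : Type} [Ring G] [Algebra A G]
    [CommRing D] [Algebra A D]
    (πD : G →ₐ[A] D) (ΔG : G →ₐ[A] G ⊗[A] G) : G →ₗ[A] G ⊗[A] D :=
  TensorProduct.map LinearMap.id πD.toLinearMap ∘ₗ ΔG.toLinearMap

/-- The weight space of weight `ta : D` for the grading induced by `ρ_D`. -/
def weightSpace' {A : Type} [CommRing A] {G D : Type} [Ring G] [Algebra A G]
    [CommRing D] [Algebra A D]
    (πD : G →ₐ[A] D) (ΔG : G →ₐ[A] G ⊗[A] G) (ta : D) : Submodule A G :=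
  LinearMap.ker (rightCoact πD ΔG - (TensorProduct.mk A G D).flip ta)

/-- The subcomodule generated by a subset `s` of the comodule `(M, b)`. -/
def comodGen {A : Type} [CommRing A] {M G : Type} [Ring M] [Algebra A M] [Ring G] [Algebra A G]
    (b : M →ₗ[A] M ⊗[A] G) (s : Set M) : Submodule A M :=
  sInf {W : Submodule A M | s ⊆ W ∧
    ∀ w ∈ W, b w ∈ LinearMap.range (TensorProduct.map W.subtype (LinearMap.id : G →ₗ[A] G))}

/-- The product `x_{K₁J₁} ⋯ x_{KₙJₙ}` attached to two words `K`, `J`. -/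
def wordProd {G : Type*} [Monoid G] {N n : ℕ} (x : Fin N → Fin N → G) (K J : Fin n → Fin N) : G :=
  (List.ofFn fun s => x (K s) (J s)).prod

/-- The reversed product `y_{KₙJₙ} ⋯ y_{K₁J₁}` attached to two words `K`, `J`. -/
def wordProdRev {G : Type*} [Monoid G] {N n : ℕ} (y : Fin N → Fin N → G)
    (K J : Fin n → Fin N) : G :=
  (List.ofFn fun s => y (K s) (J s)).reverse.prod

section Words

variable {G : Type*} {N n : ℕ}

lemma wordProd_zero [Monoid G] (x : Fin N → Fin N → G) (K J : Fin 0 → Fin N) :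
    wordProd x K J = 1 := by simp [wordProd]

lemma wordProdRev_zero [Monoid G] (x : Fin N → Fin N → G) (K J : Fin 0 → Fin N) :
    wordProdRev x K J = 1 := by simp [wordProdRev]

lemma wordProd_succ [Monoid G] (x : Fin N → Fin N → G) (K J : Fin (n + 1) → Fin N) :
    wordProd x K J = x (K 0) (J 0) * wordProd x (Fin.tail K) (Fin.tail J) := by
  simp [wordProd, List.ofFn_succ, Fin.tail]

lemma wordProd_cons [Monoid G] (x : Fin N → Fin N → G) (k j : Fin N) (K J : Fin n → Fin N) :
    wordProd x (Fin.cons k K : Fin (n + 1) → Fin N) (Fin.cons j J : Fin (n + 1) → Fin N) =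
      x k j * wordProd x K J := by
  simp [wordProd_succ]

lemma wordProd_snoc [Monoid G] (x : Fin N → Fin N → G) (k j : Fin N) (K J : Fin n → Fin N) :
    wordProd x (Fin.snoc K k : Fin (n + 1) → Fin N) (Fin.snoc J j : Fin (n + 1) → Fin N) =
      wordProd x K J * x k j := by
  rw [wordProd, List.ofFn_succ']
  simp [wordProd]

lemma wordProdRev_cons [Monoid G] (x : Fin N → Fin N → G) (k j : Fin N) (K J : Fin n → Fin N) :
    wordProdRev x (Fin.cons k K : Fin (n + 1) → Fin N) (Fin.cons j J : Fin (n + 1) → Fin N) =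
      wordProdRev x K J * x k j := by
  simp [wordProdRev, List.ofFn_succ]

lemma wordProdRev_snoc [Monoid G] (x : Fin N → Fin N → G) (k j : Fin N) (K J : Fin n → Fin N) :
    wordProdRev x (Fin.snoc K k : Fin (n + 1) → Fin N) (Fin.snoc J j : Fin (n + 1) → Fin N) =
      x k j * wordProdRev x K J := by
  rw [wordProdRev, List.ofFn_succ']
  simp [wordProdRev]

lemma map_wordProd [Monoid G] {H F : Type*} [Monoid H] [FunLike F G H] [MonoidHomClass F G H]
    (f : F) (x : Fin N → Fin N → G) (K J : Fin n → Fin N) :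
    f (wordProd x K J) = wordProd (fun i j => f (x i j)) K J := by
  simp [wordProd, map_list_prod, List.map_ofFn, Function.comp_def]

lemma sum_words_cons {M : Type*} [AddCommMonoid M] (f : (Fin (n + 1) → Fin N) → M) :
    ∑ K, f K = ∑ k, ∑ K : Fin n → Fin N, f (Fin.cons k K : Fin (n + 1) → Fin N) := by
  rw [← (Fin.consEquiv fun _ => Fin N).sum_comp, Fintype.sum_prod_type]
  rfl

lemma sum_words_snoc {M : Type*} [AddCommMonoid M] (f : (Fin (n + 1) → Fin N) → M) :
    ∑ K, f K = ∑ K : Fin n → Fin N, ∑ k, f (Fin.snoc K k : Fin (n + 1) → Fin N) := by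
  rw [← (Fin.snocEquiv fun _ => Fin N).sum_comp, Fintype.sum_prod_type_right]
  rfl

lemma sum_wordProd_mul_wordProdRev [Semiring G] {x y : Fin N → Fin N → G}
    (h : ∀ i j, ∑ k, x i k * y k j = if i = j then 1 else 0) (I J : Fin n → Fin N) :
    ∑ K, wordProd x I K * wordProdRev y K J = if I = J then 1 else 0 := by
  induction n with
  | zero => simp [wordProd_zero, wordProdRev_zero, Subsingleton.elim I J]
  | succ n ih =>
    rw [← Fin.cons_self_tail I, ← Fin.cons_self_tail J, sum_words_cons]
    simp only [wordProd_cons, wordProdRev_cons, Fin.cons_inj]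
    have : ∀ k, ∑ K, x (I 0) k * wordProd x (Fin.tail I) K *
        (wordProdRev y K (Fin.tail J) * y k (J 0)) =
        (if Fin.tail I = Fin.tail J then x (I 0) k * y k (J 0) else 0) := fun k => by
      have := congrArg (fun z => x (I 0) k * z * y k (J 0)) (ih (Fin.tail I) (Fin.tail J))
      simp only [Finset.mul_sum, Finset.sum_mul] at this
      simp only [mul_assoc] at this ⊢
      rw [this]
      split_ifs <;> simp
    simp only [this]
    by_cases h' : Fin.tail I = Fin.tail J <;> simp [h', h]

lemma sum_wordProdRev_mul_wordProd [Semiring G] {x y : Fin N → Fin N → G}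
    (h : ∀ i j, ∑ k, y i k * x k j = if i = j then 1 else 0) (I J : Fin n → Fin N) :
    ∑ K, wordProdRev y I K * wordProd x K J = if I = J then 1 else 0 := by
  induction n with
  | zero => simp [wordProd_zero, wordProdRev_zero, Subsingleton.elim I J]
  | succ n ih =>
    rw [← Fin.cons_self_tail I, ← Fin.cons_self_tail J, sum_words_cons]
    simp only [wordProd_cons, wordProdRev_cons, Fin.cons_inj]
    have : ∀ K, ∑ k, wordProdRev y (Fin.tail I) K * y (I 0) k *
        (x k (J 0) * wordProd x K (Fin.tail J)) =
        (if I 0 = J 0 then wordProdRev y (Fin.tail I) K * wordProd x K (Fin.tail J) else 0) :=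
      fun K => by
      have := congrArg (fun z => wordProdRev y (Fin.tail I) K * z * wordProd x K (Fin.tail J))
        (h (I 0) (J 0))
      simp only [Finset.mul_sum, Finset.sum_mul] at this
      simp only [mul_assoc] at this ⊢
      rw [this]
      split_ifs <;> simp
    rw [Finset.sum_comm]
    simp only [this]
    by_cases h' : I 0 = J 0 <;> simp [h', ih]

end Words

/-- The standard quantum matrix relations. -/
structure IsQuantumMatrix {F G : Type*} [Field F] [Ring G] [Algebra F G] {N : ℕ} (q : F)
    (x : Fin N → Fin N → G) : Prop where
  row : ∀ i j l : Fin N, j < l → x i j * x i l = q • (x i l * x i j)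
  col : ∀ i k j : Fin N, i < k → x i j * x k j = q • (x k j * x i j)
  anti : ∀ i k j l : Fin N, i < k → j < l → x i l * x k j = x k j * x i l
  diag : ∀ i k j l : Fin N, i < k → j < l →
    x i j * x k l - x k l * x i j = (q - q⁻¹) • (x i l * x k j)

/-- The coefficients `d` for which `T v = v ∘ s + d v` is the Hecke operator on words. -/
def heckeCoeff {F : Type*} [Field F] {N : ℕ} (q : F) (k l : Fin N) : F :=
  if k < l then q - q⁻¹ else if k = l then q - 1 else 0

section RTT

variable {F G : Type*} [Field F] [Ring G] [Algebra F G] {N n : ℕ} {q : F}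
  {x y : Fin N → Fin N → G}

lemma IsQuantumMatrix.rtt (hx : IsQuantumMatrix q x) (hq : q ≠ 0) (a b c d : Fin N) :
    x b c * x a d + heckeCoeff q a b • (x a c * x b d) =
      x a d * x b c + heckeCoeff q c d • (x a c * x b d) := by
  unfold heckeCoeff
  rcases lt_trichotomy a b with h | rfl | h <;> rcases lt_trichotomy c d with h' | rfl | h'
  · simp [h, h', hx.anti _ _ _ _ h h']
  · have := hx.col _ _ c h
    simp only [h, lt_irrefl, if_true, if_false, this]
    rw [← one_smul F (x b c * x a c)]
    simp only [smul_smul, ← add_smul]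
    congr 1; field_simp; ring
  · have := hx.diag _ _ _ _ h h'
    simp only [h, h'.not_gt, h'.ne', if_true, if_false, zero_smul, add_zero, ← this]
    abel
  · have := hx.row a _ _ h'
    simp only [h', lt_irrefl, if_true, if_false, this]
    rw [← one_smul F (x a d * x a c), smul_smul, smul_smul, smul_smul, ← add_smul, ← add_smul]
    congr 1; field_simp; ring
  · simp
  · have := hx.row a _ _ h'
    simp only [h'.not_gt, h'.ne', lt_irrefl, if_true, if_false, this, zero_smul, add_zero]
    rw [← one_smul F (x a c * x a d), smul_smul, smul_smul, ← add_smul]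
    congr 1; ring
  · have := hx.diag _ _ _ _ h h'
    simp only [h.not_gt, h', h.ne', if_true, if_false, zero_smul, add_zero]
    rw [hx.anti _ _ _ _ h h'] at this
    rw [← this]; abel
  · have := hx.col _ _ c h
    simp only [h.not_gt, h.ne', lt_irrefl, if_true, if_false, this, zero_smul, add_zero]
    rw [← one_smul F (x a c * x b c), smul_smul, smul_smul, ← add_smul]
    congr 1; ring
  · simp [h.not_gt, h.ne', h'.not_gt, h'.ne', hx.anti _ _ _ _ h h']

lemma tail_comp_swap_zero {α : Type*} (K : Fin (n + 2) → α) :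
    Fin.tail (Fin.tail (K ∘ Equiv.swap 0 1)) = Fin.tail (Fin.tail K) := by
  funext i
  simp only [Fin.tail, Function.comp_apply]
  rw [Equiv.swap_apply_of_ne_of_ne] <;> simp [Fin.ext_iff]

lemma tail_comp_swap_succ {α : Type*} (K : Fin (n + 2) → α) (i : Fin n) :
    Fin.tail (K ∘ Equiv.swap i.succ.castSucc i.succ.succ) =
      Fin.tail K ∘ Equiv.swap i.castSucc i.succ := by
  funext j
  simp only [Fin.tail, Function.comp_apply, ← Fin.succ_castSucc]
  rw [← (Fin.succ_injective _).map_swap]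

lemma IsQuantumMatrix.rtt_word (hx : IsQuantumMatrix q x) (hq : q ≠ 0) (i : Fin n)
    (K J : Fin (n + 1) → Fin N) :
    wordProd x (K ∘ Equiv.swap i.castSucc i.succ) J +
        heckeCoeff q (K i.castSucc) (K i.succ) • wordProd x K J =
      wordProd x K (J ∘ Equiv.swap i.castSucc i.succ) +
        heckeCoeff q (J i.castSucc) (J i.succ) • wordProd x K J := by
  induction n with
  | zero => exact i.elim0
  | succ n ih =>
    cases i using Fin.cases with
    | zero =>
      have := congrArg (· * wordProd x (Fin.tail (Fin.tail K)) (Fin.tail (Fin.tail J)))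
        (hx.rtt hq (K 0) (K 1) (J 0) (J 1))
      simp only [Fin.castSucc_zero, Fin.succ_zero_eq_one]
      simp only [add_mul, smul_mul_assoc, mul_assoc] at this
      simpa [wordProd_succ, tail_comp_swap_zero, Fin.tail] using this
    | succ i =>
      have h0 : ∀ L : Fin (n + 2) → Fin N,
          (L ∘ Equiv.swap i.succ.castSucc i.succ.succ) 0 = L 0 := fun L => by
        rw [Function.comp_apply, Equiv.swap_apply_of_ne_of_ne] <;> simp [Fin.ext_iff]
      have := congrArg (x (K 0) (J 0) * ·) (ih i (Fin.tail K) (Fin.tail J))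
      simp only [mul_add, mul_smul_comm] at this
      rw [wordProd_succ x (K ∘ _), wordProd_succ x K (J ∘ _), wordProd_succ x K J,
        tail_comp_swap_succ, tail_comp_swap_succ, h0, h0]
      exact this

end RTT

section Exchange

variable {F G : Type*} [Field F] [Ring G] [Algebra F G] {N n : ℕ} {q : F}
  {x y : Fin N → Fin N → G}

lemma IsQuantumMatrix.exchange (hx : IsQuantumMatrix q x) (hq : q ≠ 0)
    (hxy : ∀ i j, ∑ k, x i k * y k j = if i = j then 1 else 0)
    (hyx : ∀ i j, ∑ k, y i k * x k j = if i = j then 1 else 0) (p r b c : Fin N) :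
    y p r * x b c + (if b = r then ∑ a, heckeCoeff q a b • (y p a * x a c) else 0) =
      x b c * y p r + (if p = c then ∑ d, heckeCoeff q p d • (x b d * y d r) else 0) := by
  have key : ∑ a, ∑ d, y p a * (x b c * x a d + heckeCoeff q a b • (x a c * x b d)) * y d r =
      ∑ d, ∑ a, y p a * (x a d * x b c + heckeCoeff q c d • (x a c * x b d)) * y d r := by
    rw [Finset.sum_comm]
    exact Finset.sum_congr rfl fun d _ => Finset.sum_congr rfl fun a _ => by
      rw [hx.rtt hq a b c d]
  have h1 : ∀ a, ∑ d, y p a * (x b c * x a d + heckeCoeff q a b • (x a c * x b d)) * y d r =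
      y p a * x b c * (if a = r then 1 else 0) +
        heckeCoeff q a b • (y p a * x a c * (if b = r then 1 else 0)) := fun a => by
    rw [← hxy, ← hxy, Finset.mul_sum, Finset.mul_sum, Finset.smul_sum, ← Finset.sum_add_distrib]
    refine Finset.sum_congr rfl fun d _ => ?_
    simp only [mul_add, add_mul, mul_smul_comm, smul_mul_assoc, mul_assoc]
  have h2 : ∀ d, ∑ a, y p a * (x a d * x b c + heckeCoeff q c d • (x a c * x b d)) * y d r =
      (if p = d then 1 else 0) * (x b c * y d r) +
        heckeCoeff q c d • ((if p = c then 1 else 0) * (x b d * y d r)) := fun d => by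
    rw [← hyx, ← hyx, Finset.sum_mul, Finset.sum_mul, Finset.smul_sum, ← Finset.sum_add_distrib]
    refine Finset.sum_congr rfl fun d _ => ?_
    simp only [mul_add, add_mul, mul_smul_comm, smul_mul_assoc, mul_assoc]
  simp only [h1, h2, Finset.sum_add_distrib] at key
  simp only [mul_ite, mul_one, mul_zero, ite_mul, one_mul, zero_mul, Finset.sum_ite_eq,
    Finset.sum_ite_eq', Finset.mem_univ, if_true] at key
  by_cases hbr : b = r <;> by_cases hpc : p = c <;> simpa [hbr, hpc] using key

lemma sum_heckeCoeff_smul_left {M : Type*} [AddCommGroup M] [Module F M] (v : Fin N → M)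
    (b : Fin N) :
    v b + ∑ a, heckeCoeff q a b • v a = q • v b + (q - q⁻¹) • ∑ a with a < b, v a := by
  have : ∀ a, heckeCoeff q a b • v a =
      (if a = b then (q - 1) • v a else 0) + if a < b then (q - q⁻¹) • v a else 0 := fun a => by
    unfold heckeCoeff
    rcases lt_trichotomy a b with h | rfl | h
    · simp [h, h.ne]
    · simp
    · simp [h.ne', h.not_gt]
  simp only [this, Finset.sum_add_distrib, Finset.sum_ite_eq', Finset.mem_univ, if_true,
    Finset.smul_sum, Finset.sum_filter, smul_ite, smul_zero, sub_smul, one_smul]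
  abel

lemma sum_heckeCoeff_smul_right {M : Type*} [AddCommGroup M] [Module F M] (v : Fin N → M)
    (b : Fin N) :
    v b + ∑ a, heckeCoeff q b a • v a = q • v b + (q - q⁻¹) • ∑ a with b < a, v a := by
  have : ∀ a, heckeCoeff q b a • v a =
      (if a = b then (q - 1) • v a else 0) + if b < a then (q - q⁻¹) • v a else 0 := fun a => by
    unfold heckeCoeff
    rcases lt_trichotomy b a with h | rfl | h
    · simp [h, h.ne']
    · simp
    · simp [h.ne, h.ne', h.not_gt]
  simp only [this, Finset.sum_add_distrib, Finset.sum_ite_eq', Finset.mem_univ, if_true,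
    Finset.smul_sum, Finset.sum_filter, smul_ite, smul_zero, sub_smul, one_smul]
  abel

/-- The weights of the quantum trace. -/
def traceWeight {R : Type*} [Monoid R] {N : ℕ} (q : R) (p : Fin N) : R := q ^ (2 * (N - p.1))

lemma traceWeight_balance (hq : q ≠ 0) (b : Fin N) :
    traceWeight q b + ∑ a, heckeCoeff q a b * traceWeight q a = q ^ (2 * N + 1) := by
  have h := sum_heckeCoeff_smul_left (q := q) (fun a : Fin N => traceWeight q a) b
  simp only [smul_eq_mul] at h
  rw [h]
  have h2 : ∑ a : Fin N with a < b, traceWeight q a =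
      ∑ p ∈ Finset.range b, q ^ (2 * (N - p)) := by
    rw [Finset.sum_filter]
    simp only [Fin.lt_def, traceWeight]
    rw [Fin.sum_univ_eq_sum_range (fun p => if p < b.1 then q ^ (2 * (N - p)) else 0) N,
      ← Finset.sum_filter]
    congr 1
    ext p
    simp only [Finset.mem_filter, Finset.mem_range]
    omega
  rw [h2]
  have h3 : ∀ d ≤ N, q * q ^ (2 * (N - d)) +
      (q - q⁻¹) * ∑ p ∈ Finset.range d, q ^ (2 * (N - p)) = q ^ (2 * N + 1) := by
    intro d
    induction d with
    | zero => intro _; simp; ring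
    | succ d ih =>
      intro hd
      rw [← ih (by omega), Finset.sum_range_succ]
      obtain ⟨m, hm⟩ : ∃ m, N = d + 1 + m := ⟨N - (d + 1), by omega⟩
      rw [show N - (d + 1) = m by omega, show N - d = m + 1 by omega]
      field_simp
      ring
  exact h3 b b.2.le

lemma IsQuantumMatrix.sum_traceWeight (hx : IsQuantumMatrix q x) (hq : q ≠ 0)
    (hxy : ∀ i j, ∑ k, x i k * y k j = if i = j then 1 else 0)
    (hyx : ∀ i j, ∑ k, y i k * x k j = if i = j then 1 else 0) (r b : Fin N) :
    ∑ p, traceWeight q p • (y p r * x b p) =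
      if b = r then algebraMap F G (traceWeight q r) else 0 := by
  have hR : ∀ r b, ∑ p, traceWeight q p • (x b p * y p r) +
      ∑ p, traceWeight q p • ∑ d, heckeCoeff q p d • (x b d * y d r) =
      if b = r then algebraMap F G (q ^ (2 * N + 1)) else 0 := fun r b => by
    simp only [Finset.smul_sum]
    rw [Finset.sum_comm, ← Finset.sum_add_distrib]
    have : ∀ d, traceWeight q d • (x b d * y d r) +
        ∑ p, traceWeight q p • heckeCoeff q p d • (x b d * y d r) =
        q ^ (2 * N + 1) • (x b d * y d r) := fun d => by
      simp only [smul_smul, ← Finset.sum_smul, ← add_smul]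
      rw [← traceWeight_balance hq d]
      simp only [mul_comm]
    simp only [this, ← Finset.smul_sum, hxy, Algebra.algebraMap_eq_smul_one, smul_ite, smul_zero]
  have key : ∀ r b, ∑ p, traceWeight q p • (y p r * x b p) +
      (if b = r then ∑ a, heckeCoeff q a b • ∑ p, traceWeight q p • (y p a * x a p) else 0) =
      ∑ p, traceWeight q p • (x b p * y p r) +
      ∑ p, traceWeight q p • ∑ d, heckeCoeff q p d • (x b d * y d r) := fun r b => by
    have := Finset.sum_congr (rfl : Finset.univ = (Finset.univ : Finset (Fin N)))
      fun p _ => congrArg (traceWeight q p • ·) (hx.exchange hq hxy hyx p r b p)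
    simp only [smul_add, Finset.sum_add_distrib, if_true] at this
    rw [← this]
    congr 1
    split_ifs
    · simp only [Finset.smul_sum, smul_comm (traceWeight q _) (heckeCoeff q _ _)]
      exact Finset.sum_comm
    · simp
  simp only [hR] at key
  by_cases hbr : b = r
  · subst hbr
    simp only [if_true] at key ⊢
    set z : Fin N → G := fun b =>
      ∑ p, traceWeight q p • (y p b * x b p) - algebraMap F G (traceWeight q b) with hz
    have hz0 : ∀ b, q • z b + (q - q⁻¹) • ∑ a with a < b, z a = 0 := fun b => by
      rw [← sum_heckeCoeff_smul_left (q := q) z b]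
      have h1 := key b b
      have h2 := congrArg (algebraMap F G) (traceWeight_balance (N := N) hq b)
      simp only [if_true] at h1
      rw [← h2, map_add, map_sum] at h1
      simp only [hz, smul_sub, Finset.sum_sub_distrib]
      simp only [map_mul, ← Algebra.smul_def] at h1
      rw [sub_add_sub_comm, h1, sub_self]
    have hz1 : ∀ b, z b = 0 := fun b => by
      induction b using WellFoundedLT.induction with
      | ind b ih =>
        have := hz0 b
        rw [Finset.sum_eq_zero fun a ha => ih a (Finset.mem_filter.1 ha).2, smul_zero, add_zero]
          at this
        exact (smul_eq_zero_iff_right hq).1 this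
    exact sub_eq_zero.1 (hz1 b)
  · simpa [hbr] using key r b

lemma IsQuantumMatrix.mul_mem_of_exchange (hx : IsQuantumMatrix q x) (hq : q ≠ 0)
    (hxy : ∀ i j, ∑ k, x i k * y k j = if i = j then 1 else 0)
    (hyx : ∀ i j, ∑ k, y i k * x k j = if i = j then 1 else 0) (b c p r : Fin N) :
    x b c * y p r ∈ Submodule.span F
      (Set.range fun s : (Fin N × Fin N) × (Fin N × Fin N) => y s.1.1 s.1.2 * x s.2.1 s.2.2) := by
  set T := Submodule.span F
      (Set.range fun s : (Fin N × Fin N) × (Fin N × Fin N) => y s.1.1 s.1.2 * x s.2.1 s.2.2)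
  have hT : ∀ i j k l, y i j * x k l ∈ T := fun i j k l =>
    Submodule.subset_span ⟨((i, j), (k, l)), rfl⟩
  have hL : ∀ p c, x b c * y p r +
      (if p = c then ∑ d, heckeCoeff q p d • (x b d * y d r) else 0) ∈ T := fun p c => by
    rw [← hx.exchange hq hxy hyx]
    refine T.add_mem (hT _ _ _ _) ?_
    split_ifs
    · exact T.sum_mem fun a _ => T.smul_mem _ (hT _ _ _ _)
    · exact T.zero_mem
  by_cases hpc : p = c
  · subst hpc
    induction p using WellFoundedGT.induction with
    | ind p ih =>
      have hL := hL p p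
      rw [if_pos rfl, sum_heckeCoeff_smul_right (q := q) (fun d => x b d * y d r)] at hL
      have := (T.add_mem_iff_left (T.smul_mem _ (T.sum_mem fun d hd =>
        ih d (Finset.mem_filter.1 hd).2))).1 hL
      exact (T.smul_mem_iff hq).1 this
  · simpa [hpc] using hL p c

end Exchange

section QuantumDeterminant

/-- Number of inversions of a word. -/
def wordInv {N t : ℕ} (J : Fin t → Fin N) : ℕ :=
  (Finset.univ.filter fun p : Fin t × Fin t => p.1 < p.2 ∧ J p.2 < J p.1).card

/-- The coordinates of the quantum antisymmetric tensor. -/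
def antisymCoeff {F : Type*} [Field F] {N t : ℕ} (q : F) (J : Fin t → Fin N) : F :=
  open Classical in if Function.Injective J then (-q) ^ wordInv J else 0

variable {F G : Type*} [Field F] [Ring G] [Algebra F G] {N n t : ℕ} {q : F}
  {x y : Fin N → Fin N → G}

lemma wordInv_swap (J : Fin (n + 1) → Fin N) (i : Fin n) (h : J i.castSucc < J i.succ) :
    wordInv (J ∘ Equiv.swap i.castSucc i.succ) = wordInv J + 1 := by
  unfold wordInv
  set s := Equiv.swap i.castSucc i.succ with hs
  have hlt : ∀ a b : Fin (n + 1), a < b → (a, b) ≠ (i.castSucc, i.succ) → s a < s b := by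
    intro a b hab hne
    simp only [hs, Equiv.swap_apply_def]
    simp only [Fin.lt_def, Fin.ext_iff, ne_eq, Prod.mk.injEq, Fin.val_castSucc,
      Fin.val_succ] at hab hne ⊢
    split_ifs <;> (try simp only [Fin.val_castSucc, Fin.val_succ]) <;> omega
  have hss : ∀ a, s (s a) = a := fun a => by simp [hs]
  have hins : (Finset.univ.filter fun p : Fin (n + 1) × Fin (n + 1) =>
      p.1 < p.2 ∧ (J ∘ s) p.2 < (J ∘ s) p.1) =
      insert (i.castSucc, i.succ) ((Finset.univ.filter fun p : Fin (n + 1) × Fin (n + 1) =>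
        p.1 < p.2 ∧ J p.2 < J p.1).map (s.prodCongr s).toEmbedding) := by
    ext ⟨a, b⟩
    simp only [Finset.mem_filter, Finset.mem_univ, true_and, Finset.mem_insert,
      Finset.mem_map_equiv, Equiv.prodCongr_symm, Equiv.prodCongr_apply, Prod.map_apply,
      Function.comp_apply]
    have hsymm : s.symm = s := by simp [hs]
    rw [hsymm]
    constructor
    · rintro ⟨h1, h2⟩
      by_cases hab : (a, b) = (i.castSucc, i.succ)
      · exact Or.inl hab
      · exact Or.inr ⟨hlt a b h1 hab, h2⟩
    · rintro (hab | ⟨h1, h2⟩)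
      · obtain ⟨rfl, rfl⟩ := Prod.mk.inj hab
        simpa [hs] using h
      · refine ⟨?_, h2⟩
        have := hlt (s a) (s b) h1 fun he => by
          obtain ⟨h3, h4⟩ := Prod.mk.inj he
          rw [h3, h4] at h2
          exact h2.not_gt h
        rwa [hss, hss] at this
  rw [hins, Finset.card_insert_of_notMem, Finset.card_map]
  simp only [Finset.mem_map_equiv, Equiv.prodCongr_symm, Equiv.prodCongr_apply, Prod.map_apply,
    Finset.mem_filter, not_and]
  intro _ h1
  simp [hs, Fin.lt_def] at h1

lemma antisymCoeff_swap (J : Fin (n + 1) → Fin N) (i : Fin n) (h : J i.castSucc < J i.succ) :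
    antisymCoeff q (J ∘ Equiv.swap i.castSucc i.succ) = -q * antisymCoeff q J := by
  simp only [antisymCoeff, wordInv_swap J i h, pow_succ', Equiv.injective_comp, mul_ite, mul_zero]

lemma antisymCoeff_hecke (hq : q ≠ 0) (J : Fin (n + 1) → Fin N) (i : Fin n) :
    antisymCoeff q (J ∘ Equiv.swap i.castSucc i.succ) +
      heckeCoeff q (J i.castSucc) (J i.succ) * antisymCoeff q J = -q⁻¹ * antisymCoeff q J := by
  rcases lt_trichotomy (J i.castSucc) (J i.succ) with h | h | h
  · rw [antisymCoeff_swap J i h, heckeCoeff, if_pos h]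
    ring
  · have : ¬ Function.Injective J := fun hJ => (Fin.castSucc_lt_succ (i := i)).ne (hJ h)
    simp [antisymCoeff, this]
  · have h1 := antisymCoeff_swap (q := q) (J ∘ Equiv.swap i.castSucc i.succ) i (by simpa using h)
    rw [Function.comp_assoc, ← Equiv.coe_trans, Equiv.swap_swap, Equiv.coe_refl,
      Function.comp_id] at h1
    rw [heckeCoeff, if_neg h.not_gt, if_neg h.ne', h1]
    field_simp
    ring

lemma eq_antisymCoeff_smul {M : Type*} [AddCommGroup M] [Module F M]
    (hq2 : q + q⁻¹ ≠ 0) (v : (Fin (n + 1) → Fin N) → M)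
    (hv : ∀ J (i : Fin n), v (J ∘ Equiv.swap i.castSucc i.succ) +
      heckeCoeff q (J i.castSucc) (J i.succ) • v J = -q⁻¹ • v J)
    (r : Fin (n + 1) → Fin N) (hr0 : StrictMono r) (hr : ∀ J : Fin (n + 1) → Fin N,
      StrictMono J → J = r) (J : Fin (n + 1) → Fin N) :
    v J = antisymCoeff q J • v r := by
  induction hm : wordInv J using Nat.strong_induction_on generalizing J with
  | _ m ih =>
    by_cases hJ : StrictMono J
    · have h0 : wordInv r = 0 := by
        rw [wordInv, Finset.card_eq_zero, Finset.filter_eq_empty_iff]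
        rintro ⟨a, b⟩ - ⟨h1, h2⟩
        exact h2.not_gt (hr0 h1)
      rw [hr J hJ, antisymCoeff, if_pos hr0.injective, h0, pow_zero, one_smul]
    rw [Fin.strictMono_iff_lt_succ] at hJ
    push Not at hJ
    obtain ⟨i, hi⟩ := hJ
    rcases hi.eq_or_lt with h | h
    · have hni : ¬ Function.Injective J := fun hJ => (Fin.castSucc_lt_succ (i := i)).ne' (hJ h)
      have hs : J ∘ Equiv.swap i.castSucc i.succ = J := by
        funext a
        simp only [Function.comp_apply, Equiv.swap_apply_def]
        split_ifs with h1 h2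
        · rw [h1, h]
        · rw [h2, h]
        · rfl
      have := hv J i
      rw [hs, heckeCoeff, if_neg h.le.not_gt, if_pos h.symm, ← sub_eq_zero] at this
      rw [antisymCoeff, if_neg hni, zero_smul]
      refine (smul_eq_zero_iff_right hq2).1 ?_
      rw [← this]
      module
    · set J' := J ∘ Equiv.swap i.castSucc i.succ with hJ'
      have hlt : J' i.castSucc < J' i.succ := by simpa [hJ'] using h
      have hJJ : J = J' ∘ Equiv.swap i.castSucc i.succ := by
        rw [hJ', Function.comp_assoc, ← Equiv.coe_trans, Equiv.swap_swap, Equiv.coe_refl,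
          Function.comp_id]
      have h1 := hv J' i
      rw [← hJJ, heckeCoeff, if_pos hlt] at h1
      have h2 : v J = -q • v J' := by
        rw [eq_sub_of_add_eq h1]
        module
      have h3 : wordInv J = wordInv J' + 1 := by
        conv_lhs => rw [hJJ]
        exact wordInv_swap J' i hlt
      rw [h2, ih (wordInv J') (by omega) J' rfl, smul_smul]
      conv_rhs => rw [hJJ, antisymCoeff_swap J' i hlt]

lemma IsQuantumMatrix.sum_antisymCoeff_smul (hx : IsQuantumMatrix q x) (hq : q ≠ 0)
    (hq2 : q + q⁻¹ ≠ 0) (r : Fin t → Fin N) (hr0 : StrictMono r)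
    (hr : ∀ J : Fin t → Fin N, StrictMono J → J = r) (I : Fin t → Fin N) :
    ∑ J, antisymCoeff q J • wordProd x I J =
      antisymCoeff q I • ∑ J, antisymCoeff q J • wordProd x r J := by
  cases t with
  | zero => simp [Subsingleton.elim r I, antisymCoeff, Function.injective_of_subsingleton, wordInv]
  | succ n =>
    refine eq_antisymCoeff_smul (v := fun I => ∑ J, antisymCoeff q J • wordProd x I J)
      hq2 (fun I i => ?_) r hr0 hr I
    set s := Equiv.swap i.castSucc i.succ
    have h1 : ∑ J, antisymCoeff q J • wordProd x I (J ∘ s) =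
        ∑ J, antisymCoeff q (J ∘ s) • wordProd x I J := by
      rw [← (Equiv.arrowCongr s (Equiv.refl (Fin N))).sum_comp]
      refine Finset.sum_congr rfl fun J _ => ?_
      have : (Equiv.arrowCongr s (Equiv.refl (Fin N)) J) ∘ s = J := by
        ext a; simp [Equiv.arrowCongr]
      rw [this]
      congr 2
    simp only [Finset.smul_sum]
    rw [← Finset.sum_add_distrib]
    have h2 : ∀ J, antisymCoeff q J • wordProd x (I ∘ s) J +
        heckeCoeff q (I i.castSucc) (I i.succ) • antisymCoeff q J • wordProd x I J =
        antisymCoeff q J • wordProd x I (J ∘ s) +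
        (heckeCoeff q (J i.castSucc) (J i.succ) * antisymCoeff q J) • wordProd x I J := fun J => by
      rw [mul_comm, mul_smul, smul_comm, ← smul_add, ← smul_add, hx.rtt_word hq i I J]
    simp only [h2, Finset.sum_add_distrib, h1]
    simp only [← Finset.sum_add_distrib, ← add_smul, antisymCoeff_hecke hq, smul_smul, s]

lemma qdet_eq_sum {F G : Type} [Field F] [Ring G] [Algebra F G] {N : ℕ} (q : F)
    (x : Fin N → Fin N → G) :
    qdet q x = ∑ J, antisymCoeff q J • wordProd x
      (fun k => ((Finset.univ : Finset (Fin N)).orderIsoOfFin rfl k).1) J := by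
  set r : Fin (Finset.univ : Finset (Fin N)).card → Fin N :=
    fun k => ((Finset.univ : Finset (Fin N)).orderIsoOfFin rfl k).1 with hr
  have hrm : StrictMono r := fun a b h =>
    ((Finset.univ : Finset (Fin N)).orderIsoOfFin rfl).strictMono h
  have hrs : Function.Surjective r := fun b =>
    ⟨((Finset.univ : Finset (Fin N)).orderIsoOfFin rfl).symm ⟨b, Finset.mem_univ b⟩,
      congrArg Subtype.val (OrderIso.apply_symm_apply _ _)⟩
  rw [qdet, qMinor]
  refine Finset.sum_of_injOn (fun σ => r ∘ σ) ?_
    (fun _ _ => Finset.mem_coe.2 (Finset.mem_univ _)) ?_ ?_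
  · intro σ _ τ _ h
    ext a
    have := hrm.injective (congrFun h a)
    rw [this]
  · intro J _ hJ
    rw [antisymCoeff, if_neg, zero_smul]
    intro hinj
    refine hJ ⟨Equiv.ofBijective (fun a => Function.surjInv hrs (J a)) ?_,
      Finset.mem_coe.2 (Finset.mem_univ _), ?_⟩
    · exact Finite.injective_iff_bijective.1 ((Function.injective_surjInv hrs).comp hinj)
    · funext a
      exact Function.surjInv_eq hrs (J a)
  · intro σ _
    have : wordInv (r ∘ σ) = invCount σ := by
      simp only [wordInv, invCount, Function.comp_apply, hrm.lt_iff_lt]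
    rw [antisymCoeff, if_pos (hrm.injective.comp σ.injective), this, wordProd,
      List.ofFn_eq_map]
    rfl

lemma IsQuantumMatrix.eq_of_qdet_mul_eq_one {F G : Type} [Field F] [Ring G] [Algebra F G]
    {N : ℕ} {q : F} {x y : Fin N → Fin N → G} (hx : IsQuantumMatrix q x) (hq : q ≠ 0)
    (hq2 : q + q⁻¹ ≠ 0) (hyx : ∀ i j, ∑ k, y i k * x k j = if i = j then 1 else 0)
    {D : G} (hD : qdet q x * D = 1) :
    ∃ (t : ℕ) (r : Fin t → Fin N), D = ∑ I, antisymCoeff q I • wordProdRev y r I := by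
  set r : Fin (Finset.univ : Finset (Fin N)).card → Fin N :=
    fun k => ((Finset.univ : Finset (Fin N)).orderIsoOfFin rfl k).1 with hr
  have hrm : StrictMono r := fun a b h =>
    ((Finset.univ : Finset (Fin N)).orderIsoOfFin rfl).strictMono h
  have hru : ∀ J : Fin (Finset.univ : Finset (Fin N)).card → Fin N, StrictMono J → J = r := by
    intro J hJ
    have h1 := Finset.orderEmbOfFin_unique (s := Finset.univ) rfl (f := J) (by simp) hJ
    have h2 := Finset.orderEmbOfFin_unique (s := Finset.univ) rfl (f := r) (by simp) hrm
    rw [h1, h2]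
  refine ⟨_, r, ?_⟩
  refine (left_inv_eq_right_inv (a := qdet q x) ?_ hD).symm
  rw [qdet_eq_sum, Finset.sum_mul]
  have h1 : ∀ I, antisymCoeff q I • wordProdRev y r I * ∑ J, antisymCoeff q J • wordProd x r J =
      ∑ J, antisymCoeff q J • (wordProdRev y r I * wordProd x I J) := fun I => by
    rw [smul_mul_assoc, ← mul_smul_comm, ← hx.sum_antisymCoeff_smul hq hq2 r hrm hru,
      Finset.mul_sum]
    simp only [mul_smul_comm]
  simp only [← hr, h1]
  rw [Finset.sum_comm]
  simp only [← Finset.smul_sum, sum_wordProdRev_mul_wordProd hyx]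
  have h0 : wordInv r = 0 := by
    rw [wordInv, Finset.card_eq_zero, Finset.filter_eq_empty_iff]
    rintro ⟨a, b⟩ - ⟨h1, h2⟩
    exact h2.not_gt (hrm h1)
  simp only [smul_ite, smul_zero]
  rw [Finset.sum_ite_eq, if_pos (Finset.mem_univ _), antisymCoeff, if_pos hrm.injective, h0,
    pow_zero, one_smul]

end QuantumDeterminant

section OrbitCoeffs

variable {F G : Type*} [Field F] [Ring G] [Algebra F G] {N n : ℕ} {q : F}

/-- The combination with coefficients `c` of the products `wordProdRev y I K * wordProd x L J`. -/
def wordComb (x y : Fin N → Fin N → G) (c : (Fin n → Fin N) → (Fin n → Fin N) → F)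
    (I J : Fin n → Fin N) : G :=
  ∑ K, ∑ L, c K L • (wordProdRev y I K * wordProd x L J)

/-- The coefficients all of whose combinations lie in `V`. -/
def wordCoeffs (x y : Fin N → Fin N → G) (V : Submodule F G) (n : ℕ) :
    Submodule F ((Fin n → Fin N) → (Fin n → Fin N) → F) where
  carrier := {c | ∀ I J, wordComb x y c I J ∈ V}
  add_mem' hc hd I J := by
    have := V.add_mem (hc I J) (hd I J)
    simpa only [wordComb, Pi.add_apply, add_smul, Finset.sum_add_distrib] using this
  zero_mem' I J := by simp [wordComb]
  smul_mem' a c hc I J := by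
    have := V.smul_mem a (hc I J)
    simpa only [wordComb, Pi.smul_apply, smul_assoc, Finset.smul_sum] using this

variable {x y : Fin N → Fin N → G} {V : Submodule F G}

lemma one_mem_wordCoeffs (hyx : ∀ i j, ∑ k, y i k * x k j = if i = j then 1 else 0)
    (h1 : (1 : G) ∈ V) :
    (fun K L => if K = L then 1 else 0) ∈ wordCoeffs x y V n := fun I J => by
  simp only [wordComb, ite_smul, one_smul, zero_smul, Finset.sum_ite_eq, Finset.mem_univ, if_true,
    sum_wordProdRev_mul_wordProd hyx]
  split_ifs
  exacts [h1, V.zero_mem]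

lemma sum_words_comp {M : Type*} [AddCommMonoid M] (s : Equiv.Perm (Fin n))
    (f : (Fin n → Fin N) → M) : ∑ K : Fin n → Fin N, f (K ∘ s) = ∑ K, f K :=
  (Equiv.arrowCongr s.symm (Equiv.refl (Fin N))).sum_comp f

lemma hecke_left_mem_wordCoeffs
    (hy : ∀ (i : Fin n) (K J : Fin (n + 1) → Fin N),
      wordProdRev y (K ∘ Equiv.swap i.castSucc i.succ) J +
        heckeCoeff q (K i.castSucc) (K i.succ) • wordProdRev y K J =
      wordProdRev y K (J ∘ Equiv.swap i.castSucc i.succ) +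
        heckeCoeff q (J i.castSucc) (J i.succ) • wordProdRev y K J)
    {c : (Fin (n + 1) → Fin N) → (Fin (n + 1) → Fin N) → F} (hc : c ∈ wordCoeffs x y V (n + 1))
    (i : Fin n) :
    (fun K L => c (K ∘ Equiv.swap i.castSucc i.succ) L +
      heckeCoeff q (K i.castSucc) (K i.succ) * c K L) ∈ wordCoeffs x y V (n + 1) := fun I J => by
  have h := V.add_mem (hc (I ∘ Equiv.swap i.castSucc i.succ) J)
    (V.smul_mem (heckeCoeff q (I i.castSucc) (I i.succ)) (hc I J))
  set s := Equiv.swap i.castSucc i.succ with hs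
  have hss : ∀ K : Fin (n + 1) → Fin N, (K ∘ s) ∘ s = K := fun K => by
    funext a; simp [hs]
  convert h using 1
  simp only [wordComb, add_smul, Finset.sum_add_distrib, Finset.smul_sum]
  rw [← sum_words_comp s fun K => ∑ L, c (K ∘ s) L • (wordProdRev y I K * wordProd x L J)]
  simp only [hss, ← Finset.sum_add_distrib]
  refine Finset.sum_congr rfl fun K _ => Finset.sum_congr rfl fun L _ => ?_
  rw [mul_comm, mul_smul, smul_comm (heckeCoeff q (I i.castSucc) (I i.succ)), ← smul_add,
    ← smul_add, ← smul_mul_assoc, ← smul_mul_assoc, ← add_mul, ← add_mul, ← hy]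

lemma hecke_right_mem_wordCoeffs
    (hx : ∀ (i : Fin n) (K J : Fin (n + 1) → Fin N),
      wordProd x (K ∘ Equiv.swap i.castSucc i.succ) J +
        heckeCoeff q (K i.castSucc) (K i.succ) • wordProd x K J =
      wordProd x K (J ∘ Equiv.swap i.castSucc i.succ) +
        heckeCoeff q (J i.castSucc) (J i.succ) • wordProd x K J)
    {c : (Fin (n + 1) → Fin N) → (Fin (n + 1) → Fin N) → F} (hc : c ∈ wordCoeffs x y V (n + 1))
    (i : Fin n) :
    (fun K L => c K (L ∘ Equiv.swap i.castSucc i.succ) +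
      heckeCoeff q (L i.castSucc) (L i.succ) * c K L) ∈ wordCoeffs x y V (n + 1) := fun I J => by
  have h := V.add_mem (hc I (J ∘ Equiv.swap i.castSucc i.succ))
    (V.smul_mem (heckeCoeff q (J i.castSucc) (J i.succ)) (hc I J))
  set s := Equiv.swap i.castSucc i.succ with hs
  have hss : ∀ K : Fin (n + 1) → Fin N, (K ∘ s) ∘ s = K := fun K => by
    funext a; simp [hs]
  convert h using 1
  simp only [wordComb, add_smul, Finset.sum_add_distrib, Finset.smul_sum]
  simp only [← sum_words_comp s fun L => c _ (L ∘ s) • (wordProdRev y I _ * wordProd x L J)]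
  simp only [hss, ← Finset.sum_add_distrib]
  refine Finset.sum_congr rfl fun K _ => Finset.sum_congr rfl fun L _ => ?_
  rw [mul_comm, mul_smul, smul_comm (heckeCoeff q (J i.castSucc) (J i.succ)), ← smul_add,
    ← smul_add, ← mul_smul_comm, ← mul_smul_comm, ← mul_add, ← mul_add, hx]

lemma wordComb_snoc (a : Fin N → F) (c : (Fin n → Fin N) → (Fin n → Fin N) → F)
    (I J : Fin (n + 1) → Fin N) :
    wordComb x y (fun K L => if K (Fin.last n) = L (Fin.last n) then
      c (Fin.init K) (Fin.init L) * a (K (Fin.last n)) else 0) I J =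
      ∑ k, a k • (y (I (Fin.last n)) k * wordComb x y c (Fin.init I) (Fin.init J) *
        x k (J (Fin.last n))) := by
  conv_lhs => rw [← Fin.snoc_init_self I, ← Fin.snoc_init_self J]
  simp only [wordComb, sum_words_snoc, Fin.snoc_last, Fin.init_snoc, wordProdRev_snoc,
    wordProd_snoc, ite_smul, zero_smul, Finset.sum_ite_eq, Finset.mem_univ, if_true]
  simp only [Finset.mul_sum, Finset.sum_mul, Finset.smul_sum]
  rw [Finset.sum_comm' (t' := Finset.univ) (s' := fun _ => Finset.univ) (by simp)]
  simp only [Finset.sum_comm (s := (Finset.univ : Finset (Fin N)))]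
  refine Finset.sum_congr rfl fun K _ => Finset.sum_congr rfl fun L _ =>
    Finset.sum_congr rfl fun k _ => ?_
  simp only [mul_smul_comm, smul_mul_assoc, smul_smul, mul_assoc, mul_comm]

lemma snoc_mem_wordCoeffs {a : Fin N → F}
    (hV : ∀ f ∈ V, ∀ i j, ∑ k, a k • (y i k * f * x k j) ∈ V)
    {c : (Fin n → Fin N) → (Fin n → Fin N) → F} (hc : c ∈ wordCoeffs x y V n) :
    (fun K L => if K (Fin.last n) = L (Fin.last n) then
      c (Fin.init K) (Fin.init L) * a (K (Fin.last n)) else 0) ∈ wordCoeffs x y V (n + 1) :=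
  fun I J => by
  rw [wordComb_snoc]
  exact hV _ (hc (Fin.init I) (Fin.init J)) (I (Fin.last n)) (J (Fin.last n))

lemma trace_mem_wordCoeffs
    (htr : ∀ r b, ∑ p, traceWeight q p • (y p r * x b p) =
      if b = r then algebraMap F G (traceWeight q r) else 0)
    {c : (Fin (n + 1) → Fin N) → (Fin (n + 1) → Fin N) → F} (hc : c ∈ wordCoeffs x y V (n + 1)) :
    (fun K L => ∑ k, traceWeight q k * c (Fin.cons k K : Fin (n + 1) → Fin N)
      (Fin.cons k L : Fin (n + 1) → Fin N)) ∈ wordCoeffs x y V n := fun I J => by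
  convert V.sum_mem (t := Finset.univ) fun p _ =>
    V.smul_mem (traceWeight q p) (hc (Fin.cons p I) (Fin.cons p J)) using 1
  have key : ∀ (A B : G) (k l : Fin N), ∑ p, traceWeight q p • (A * y p k * (x l p * B)) =
      if k = l then traceWeight q k • (A * B) else 0 := fun A B k l => by
    have h := congrArg (fun z => A * z * B) (htr k l)
    simp only [Finset.mul_sum, Finset.sum_mul, mul_smul_comm, smul_mul_assoc, mul_assoc] at h
    simp only [mul_assoc, h]
    by_cases hkl : k = l
    · rw [if_pos hkl, if_pos hkl.symm, Algebra.algebraMap_eq_smul_one, smul_one_mul,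
        mul_smul_comm]
    · rw [if_neg hkl, if_neg (Ne.symm hkl), zero_mul, mul_zero]
  have h2 : ∀ K L : Fin n → Fin N, ∑ p, ∑ k, ∑ l, traceWeight q p •
      c (Fin.cons k K : Fin (n + 1) → Fin N) (Fin.cons l L : Fin (n + 1) → Fin N) •
        (wordProdRev y I K * y p k * (x l p * wordProd x L J)) =
      ∑ k, (traceWeight q k * c (Fin.cons k K : Fin (n + 1) → Fin N)
        (Fin.cons k L : Fin (n + 1) → Fin N)) • (wordProdRev y I K * wordProd x L J) :=
    fun K L => by
    rw [Finset.sum_comm]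
    refine Finset.sum_congr rfl fun k _ => ?_
    rw [Finset.sum_comm]
    simp only [smul_comm (traceWeight q _) (c _ _), ← Finset.smul_sum, key, smul_ite, smul_zero,
      Finset.sum_ite_eq, Finset.mem_univ, if_true]
    rw [mul_comm, mul_smul]
  simp only [wordComb, sum_words_cons, wordProdRev_cons, wordProd_cons, Finset.smul_sum,
    Finset.sum_smul, ← h2]
  simp only [Finset.sum_comm (s := (Finset.univ : Finset (Fin n → Fin N)))
    (t := (Finset.univ : Finset (Fin N)))]

end OrbitCoeffs

section Specialization

open Polynomial

variable {k F G : Type*} [Field k] [Field F] [Algebra k[X] F] [Ring G] [Algebra F G] {N n : ℕ}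
  {x y : Fin N → Fin N → G} {V : Submodule F G}

/-- The values at `1` of the polynomial elements of `wordCoeffs x y V n`. -/
def specCoeffs (k : Type*) {F G : Type*} [Field k] [Field F] [Algebra k[X] F] [Ring G]
    [Algebra F G] {N : ℕ} (x y : Fin N → Fin N → G) (V : Submodule F G) (n : ℕ) :
    Submodule k ((Fin n → Fin N) → (Fin n → Fin N) → k) where
  carrier := {c | ∃ p : (Fin n → Fin N) → (Fin n → Fin N) → k[X],
    (fun K L => algebraMap k[X] F (p K L)) ∈ wordCoeffs x y V n ∧
      (fun K L => (p K L).eval 1) = c}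
  add_mem' := by
    rintro _ _ ⟨p, hp, rfl⟩ ⟨r, hr, rfl⟩
    refine ⟨p + r, ?_, by ext; simp⟩
    convert Submodule.add_mem _ hp hr using 1
    ext; simp
  zero_mem' := by
    refine ⟨0, ?_, by ext; simp⟩
    convert Submodule.zero_mem (wordCoeffs x y V n) using 1
    ext; simp
  smul_mem' := by
    rintro a _ ⟨p, hp, rfl⟩
    refine ⟨fun K L => C a * p K L, ?_, by ext; simp⟩
    convert Submodule.smul_mem _ (algebraMap k[X] F (C a)) hp using 1
    ext; simp

/-- The hypotheses on the submodule `V` under which coefficients can be moved around. -/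
structure IsOrbitSubmodule (a : Fin N → k[X]) (x y : Fin N → Fin N → G) (V : Submodule F G) :
    Prop where
  one_mem : 1 ∈ V
  sum_mem : ∀ f ∈ V, ∀ i j, ∑ l, algebraMap k[X] F (a l) • (y i l * f * x l j) ∈ V
  sum_mul : ∀ i j, ∑ l, y i l * x l j = if i = j then 1 else 0
  sum_traceWeight : ∀ r b, ∑ p, traceWeight (algebraMap k[X] F X) p • (y p r * x b p) =
      if b = r then algebraMap F G (traceWeight (algebraMap k[X] F X) r) else 0
  rtt : ∀ (n : ℕ) (i : Fin n) (K J : Fin (n + 1) → Fin N),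
      wordProd x (K ∘ Equiv.swap i.castSucc i.succ) J +
        heckeCoeff (algebraMap k[X] F X) (K i.castSucc) (K i.succ) • wordProd x K J =
      wordProd x K (J ∘ Equiv.swap i.castSucc i.succ) +
        heckeCoeff (algebraMap k[X] F X) (J i.castSucc) (J i.succ) • wordProd x K J
  rtt_rev : ∀ (n : ℕ) (i : Fin n) (K J : Fin (n + 1) → Fin N),
      wordProdRev y (K ∘ Equiv.swap i.castSucc i.succ) J +
        heckeCoeff (algebraMap k[X] F X) (K i.castSucc) (K i.succ) • wordProdRev y K J =
      wordProdRev y K (J ∘ Equiv.swap i.castSucc i.succ) +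
        heckeCoeff (algebraMap k[X] F X) (J i.castSucc) (J i.succ) • wordProdRev y K J

variable {a : Fin N → k[X]}

/-- The polynomial `X * heckeCoeff X`. -/
def heckePoly (k : Type*) [Field k] {N : ℕ} (i j : Fin N) : k[X] :=
  if i < j then X ^ 2 - 1 else if i = j then X * (X - 1) else 0

lemma algebraMap_heckePoly [FaithfulSMul k[X] F] (i j : Fin N) :
    algebraMap k[X] F (heckePoly k i j) =
      algebraMap k[X] F X * heckeCoeff (algebraMap k[X] F X) i j := by
  have : algebraMap k[X] F X ≠ 0 := by simp
  unfold heckePoly heckeCoeff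
  split_ifs
  · simp only [map_sub, map_pow, map_one]
    field_simp
  · simp
  · simp

lemma eval_heckePoly (i j : Fin N) : (heckePoly k i j).eval 1 = 0 := by
  unfold heckePoly
  split_ifs <;> simp

namespace IsOrbitSubmodule

lemma one_mem_specCoeffs (h : IsOrbitSubmodule a x y V) :
    (fun K L => if K = L then 1 else 0) ∈ specCoeffs k x y V n := by
  refine ⟨fun K L => if K = L then 1 else 0, ?_, ?_⟩
  · convert one_mem_wordCoeffs h.sum_mul h.one_mem using 3
    split_ifs <;> simp [*]
  · ext K L
    split_ifs <;> simp [*]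

lemma comp_swap_left [FaithfulSMul k[X] F] (h : IsOrbitSubmodule a x y V)
    {c : (Fin (n + 1) → Fin N) → (Fin (n + 1) → Fin N) → k}
    (hc : c ∈ specCoeffs k x y V (n + 1)) (i : Fin n) :
    (fun K L => c (K ∘ Equiv.swap i.castSucc i.succ) L) ∈ specCoeffs k x y V (n + 1) := by
  obtain ⟨p, hp, rfl⟩ := hc
  refine ⟨fun K L => X * p (K ∘ Equiv.swap i.castSucc i.succ) L +
    heckePoly k (K i.castSucc) (K i.succ) * p K L, ?_, ?_⟩
  · convert Submodule.smul_mem _ (algebraMap k[X] F X)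
      (hecke_left_mem_wordCoeffs (h.rtt_rev n) hp i) using 1
    ext K L
    simp [algebraMap_heckePoly, mul_add, mul_assoc]
  · ext K L
    simp [eval_heckePoly]

lemma comp_swap_right [FaithfulSMul k[X] F] (h : IsOrbitSubmodule a x y V)
    {c : (Fin (n + 1) → Fin N) → (Fin (n + 1) → Fin N) → k}
    (hc : c ∈ specCoeffs k x y V (n + 1)) (i : Fin n) :
    (fun K L => c K (L ∘ Equiv.swap i.castSucc i.succ)) ∈ specCoeffs k x y V (n + 1) := by
  obtain ⟨p, hp, rfl⟩ := hc
  refine ⟨fun K L => X * p K (L ∘ Equiv.swap i.castSucc i.succ) +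
    heckePoly k (L i.castSucc) (L i.succ) * p K L, ?_, ?_⟩
  · convert Submodule.smul_mem _ (algebraMap k[X] F X)
      (hecke_right_mem_wordCoeffs (h.rtt n) hp i) using 1
    ext K L
    simp [algebraMap_heckePoly, mul_add, mul_assoc]
  · ext K L
    simp [eval_heckePoly]

lemma comp_perm_left [FaithfulSMul k[X] F] (h : IsOrbitSubmodule a x y V)
    {c : (Fin n → Fin N) → (Fin n → Fin N) → k} (hc : c ∈ specCoeffs k x y V n)
    (σ : Equiv.Perm (Fin n)) : (fun K L => c (K ∘ σ) L) ∈ specCoeffs k x y V n := by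
  cases n with
  | zero => simpa [Subsingleton.elim σ 1] using hc
  | succ n =>
    have hσ : σ ∈ Submonoid.closure (Set.range fun i : Fin n => Equiv.swap i.castSucc i.succ) := by
      rw [Equiv.Perm.mclosure_swap_castSucc_succ]; trivial
    induction hσ using Submonoid.closure_induction generalizing c with
    | mem s hs =>
      obtain ⟨i, rfl⟩ := hs
      exact h.comp_swap_left hc i
    | one => exact hc
    | mul σ τ _ _ ihσ ihτ => exact ihσ (ihτ hc)

lemma comp_perm_right [FaithfulSMul k[X] F] (h : IsOrbitSubmodule a x y V)
    {c : (Fin n → Fin N) → (Fin n → Fin N) → k} (hc : c ∈ specCoeffs k x y V n)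
    (σ : Equiv.Perm (Fin n)) : (fun K L => c K (L ∘ σ)) ∈ specCoeffs k x y V n := by
  cases n with
  | zero => simpa [Subsingleton.elim σ 1] using hc
  | succ n =>
    have hσ : σ ∈ Submonoid.closure (Set.range fun i : Fin n => Equiv.swap i.castSucc i.succ) := by
      rw [Equiv.Perm.mclosure_swap_castSucc_succ]; trivial
    induction hσ using Submonoid.closure_induction generalizing c with
    | mem s hs =>
      obtain ⟨i, rfl⟩ := hs
      exact h.comp_swap_right hc i
    | one => exact hc
    | mul σ τ _ _ ihσ ihτ => exact ihσ (ihτ hc)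

lemma snoc_mem_specCoeffs (h : IsOrbitSubmodule a x y V)
    {c : (Fin n → Fin N) → (Fin n → Fin N) → k} (hc : c ∈ specCoeffs k x y V n) :
    (fun K L => if K (Fin.last n) = L (Fin.last n) then
      c (Fin.init K) (Fin.init L) * (a (K (Fin.last n))).eval 1 else 0) ∈
        specCoeffs k x y V (n + 1) := by
  obtain ⟨p, hp, rfl⟩ := hc
  refine ⟨fun K L => if K (Fin.last n) = L (Fin.last n) then
      p (Fin.init K) (Fin.init L) * a (K (Fin.last n)) else 0, ?_, ?_⟩
  · convert snoc_mem_wordCoeffs h.sum_mem hp using 3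
    split_ifs <;> simp [*]
  · ext K L
    split_ifs <;> simp [*]

lemma trace_mem_specCoeffs (h : IsOrbitSubmodule a x y V)
    {c : (Fin (n + 1) → Fin N) → (Fin (n + 1) → Fin N) → k}
    (hc : c ∈ specCoeffs k x y V (n + 1)) :
    (fun K L => ∑ l, c (Fin.cons l K : Fin (n + 1) → Fin N)
      (Fin.cons l L : Fin (n + 1) → Fin N)) ∈ specCoeffs k x y V n := by
  obtain ⟨p, hp, rfl⟩ := hc
  refine ⟨fun K L => ∑ l, traceWeight X l * p (Fin.cons l K : Fin (n + 1) → Fin N)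
      (Fin.cons l L : Fin (n + 1) → Fin N), ?_, ?_⟩
  · convert trace_mem_wordCoeffs h.sum_traceWeight hp using 3
    simp [traceWeight]
  · ext K L
    simp [traceWeight, eval_finsetSum]

lemma mul_eval_mem_specCoeffs [FaithfulSMul k[X] F] (h : IsOrbitSubmodule a x y V)
    {c : (Fin n → Fin N) → (Fin n → Fin N) → k} (hc : c ∈ specCoeffs k x y V n) (s : Fin n) :
    (fun K L => c K L * (a (K s)).eval 1) ∈ specCoeffs k x y V n := by
  set r := finRotate (n + 1) with hr
  have h1 : ∀ i : Fin n, r i.castSucc = i.succ := fun i => by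
    rw [hr]; ext; rw [coe_finRotate, if_neg i.castSucc_lt_last.ne]; simp
  have h2 : r (Fin.last n) = 0 := finRotate_last
  convert h.trace_mem_specCoeffs (h.comp_perm_left (h.comp_perm_right (h.snoc_mem_specCoeffs hc) r)
    (r * Equiv.swap s.castSucc (Fin.last n))) using 1
  ext K L
  have hL : ∀ l, Fin.init ((Fin.cons l L : Fin (n + 1) → Fin N) ∘ r) = L := fun l => by
    funext i; simp [Fin.init, h1]
  have hK : Fin.init ((Fin.cons (K s) K : Fin (n + 1) → Fin N) ∘
      (r * Equiv.swap s.castSucc (Fin.last n) : Equiv.Perm (Fin (n + 1)))) = K := by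
    funext i
    by_cases hi : i = s
    · subst hi
      simp [Fin.init, h2]
    · simp [Fin.init, Equiv.swap_apply_of_ne_of_ne, hi, i.castSucc_lt_last.ne, h1]
  rw [Finset.sum_eq_single (K s)]
  · simp only [hL, hK]
    simp [h1, h2]
  · intro l _ hl
    simp [h1, h2, hl.symm]
  · simp

lemma ite_apply_mem_specCoeffs [FaithfulSMul k[X] F] (h : IsOrbitSubmodule a x y V)
    (ha : Function.Injective fun i => (a i).eval 1)
    {c : (Fin n → Fin N) → (Fin n → Fin N) → k} (hc : c ∈ specCoeffs k x y V n) (s : Fin n)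
    (m : Fin N) : (fun K L => if K s = m then c K L else 0) ∈ specCoeffs k x y V n := by
  have key : ∀ S : Finset (Fin N),
      (fun K L => c K L * ∏ l ∈ S, ((a (K s)).eval 1 - (a l).eval 1)) ∈ specCoeffs k x y V n := by
    intro S
    induction S using Finset.induction_on with
    | empty => simpa using hc
    | insert l S hl ih =>
      convert Submodule.sub_mem _ (h.mul_eval_mem_specCoeffs ih s)
        (Submodule.smul_mem _ ((a l).eval 1) ih) using 1
      ext K L
      simp only [Finset.prod_insert hl, Pi.sub_apply, Pi.smul_apply, smul_eq_mul]
      ring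
  convert Submodule.smul_mem _ (∏ l ∈ Finset.univ.erase m, ((a m).eval 1 - (a l).eval 1))⁻¹
    (key (Finset.univ.erase m)) using 1
  ext K L
  simp only [Pi.smul_apply, smul_eq_mul]
  split_ifs with hs
  · subst hs
    rw [mul_comm, mul_assoc, mul_inv_cancel₀, mul_one]
    exact Finset.prod_ne_zero_iff.2 fun l hl =>
      sub_ne_zero.2 fun e => (Finset.mem_erase.1 hl).1 (ha e.symm)
  · have h0 : ∏ l ∈ Finset.univ.erase m, ((a (K s)).eval 1 - (a l).eval 1) = 0 :=
      Finset.prod_eq_zero (Finset.mem_erase.2 ⟨hs, Finset.mem_univ (K s)⟩) (sub_self _)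
    rw [h0, mul_zero, mul_zero]

lemma single_mem_specCoeffs [FaithfulSMul k[X] F] (h : IsOrbitSubmodule a x y V)
    (ha : Function.Injective fun i => (a i).eval 1) (K₀ : Fin n → Fin N)
    (σ : Equiv.Perm (Fin n)) :
    (fun K L => if K = K₀ ∧ L = K₀ ∘ σ then 1 else 0) ∈ specCoeffs k x y V n := by
  have key : ∀ S : Finset (Fin n),
      (fun K L => if ∀ s ∈ S, K s = K₀ s then if K = L then 1 else 0 else 0) ∈
        specCoeffs k x y V n := by
    intro S
    induction S using Finset.induction_on with
    | empty => simpa using h.one_mem_specCoeffs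
    | insert l S hl ih =>
      convert h.ite_apply_mem_specCoeffs ha ih l (K₀ l) using 3
      simp only [Finset.forall_mem_insert, ite_and]
  convert h.comp_perm_right (key Finset.univ) σ⁻¹ using 3 with K L
  have h1 : K = L ∘ ⇑σ⁻¹ ↔ L = K ∘ σ := by
    constructor <;> rintro rfl <;> ext <;> simp
  have h2 : (∀ s ∈ Finset.univ, K s = K₀ s) ↔ K = K₀ := by simp [funext_iff]
  rw [ite_and]
  simp only [h2, h1]
  by_cases hK : K = K₀
  · subst hK
    simp
  · simp [hK]

end IsOrbitSubmodule

lemma mem_of_sum_smul_mem {ι : Type*} [Fintype ι] [DecidableEq ι] {v : ι → G} {M : Matrix ι ι F}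
    (hM : M.det ≠ 0) (hv : ∀ i, ∑ j, M i j • v j ∈ V) (i : ι) : v i ∈ V := by
  have h := V.sum_mem (t := Finset.univ) fun j _ => V.smul_mem (M⁻¹ i j) (hv j)
  convert h using 1
  simp only [Finset.smul_sum, smul_smul]
  rw [Finset.sum_comm]
  simp only [← Finset.sum_smul, ← Matrix.mul_apply,
    Matrix.nonsing_inv_mul _ (isUnit_iff_ne_zero.2 hM), Matrix.one_apply, ite_smul, one_smul,
    zero_smul, Finset.sum_ite_eq, Finset.mem_univ, if_true]

lemma IsOrbitSubmodule.wordProdRev_mul_wordProd_mem [FaithfulSMul k[X] F]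
    (h : IsOrbitSubmodule a x y V) (ha : Function.Injective fun i => (a i).eval 1)
    (P : G →ₗ[F] G) (hP : ∀ f ∈ V, P f = f)
    (hP1 : ∀ I K L J : Fin n → Fin N, (∃ σ : Equiv.Perm (Fin n), L = K ∘ σ) →
      P (wordProdRev y I K * wordProd x L J) = wordProdRev y I K * wordProd x L J)
    (hP0 : ∀ I K L J : Fin n → Fin N, (¬ ∃ σ : Equiv.Perm (Fin n), L = K ∘ σ) →
      P (wordProdRev y I K * wordProd x L J) = 0)
    (I K J : Fin n → Fin N) (σ : Equiv.Perm (Fin n)) :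
    wordProdRev y I K * wordProd x (K ∘ σ) J ∈ V := by
  classical
  let T := {t : (Fin n → Fin N) × (Fin n → Fin N) // ∃ σ : Equiv.Perm (Fin n), t.2 = t.1 ∘ σ}
  have hT : ∀ t : T, ∃ p : (Fin n → Fin N) → (Fin n → Fin N) → k[X],
      (fun K L => algebraMap k[X] F (p K L)) ∈ wordCoeffs x y V n ∧
      ∀ K L, (p K L).eval 1 = if (K, L) = t.1 then 1 else 0 := by
    rintro ⟨⟨K₀, L₀⟩, σ, hσ⟩
    obtain rfl : L₀ = K₀ ∘ σ := hσ
    obtain ⟨p, hp, hp1⟩ := h.single_mem_specCoeffs ha K₀ σ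
    refine ⟨p, hp, fun K L => ?_⟩
    simpa using congrFun (congrFun hp1 K) L
  choose p hp hp1 using hT
  let v : T → G := fun t => wordProdRev y I t.1.1 * wordProd x t.1.2 J
  let M : Matrix T T k[X] := fun t u => p t u.1.1 u.1.2
  have hM : M.det ≠ 0 := by
    have h1 : (evalRingHom (1 : k)).mapMatrix M = 1 := by
      ext t u
      rw [RingHom.mapMatrix_apply, Matrix.map_apply, Matrix.one_apply, coe_evalRingHom, hp1]
      exact if_congr (by rw [Prod.mk.eta, Subtype.ext_iff, eq_comm]) rfl rfl
    intro h0
    have := RingHom.map_det (evalRingHom (1 : k)) M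
    rw [h0, h1, map_zero, Matrix.det_one] at this
    exact zero_ne_one this
  refine mem_of_sum_smul_mem (v := v) (M := (algebraMap k[X] F).mapMatrix M) ?_ (fun t => ?_)
    ⟨(K, K ∘ σ), σ, rfl⟩
  · rw [← RingHom.map_det]
    simpa using hM
  · have h1 := hp t I J
    rw [← hP _ h1] at h1
    convert h1 using 1
    simp only [wordComb, map_sum, map_smul]
    rw [← Fintype.sum_prod_type' (f := fun K L => algebraMap k[X] F (p t K L) •
      P (wordProdRev y I K * wordProd x L J)), ← Finset.sum_subset (Finset.subset_univ
      (Finset.univ.filter fun u : (Fin n → Fin N) × (Fin n → Fin N) =>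
        ∃ σ : Equiv.Perm (Fin n), u.2 = u.1 ∘ σ)), Finset.sum_subtype
      (p := fun u : (Fin n → Fin N) × (Fin n → Fin N) =>
        ∃ σ : Equiv.Perm (Fin n), u.2 = u.1 ∘ σ) _ (fun u => by simp)]
    · exact Finset.sum_congr rfl fun u _ => by rw [hP1 I u.1.1 u.1.2 J u.2]; rfl
    · intro u _ hu
      rw [hP0 _ _ _ _ (by simpa using hu), smul_zero]

end Specialization

section Generation

variable {F G : Type*} [Field F] [Ring G] [Algebra F G] {N n m : ℕ} {x y : Fin N → Fin N → G}

lemma eq_top_of_wordProd_mem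
    (hgen : Algebra.adjoin F (Set.range fun p : Fin N × Fin N => x p.1 p.2) = ⊤)
    {V : Submodule F G} (h : ∀ n (I J : Fin n → Fin N), wordProd x I J ∈ V) : V = ⊤ := by
  rw [eq_top_iff, ← Algebra.top_toSubmodule, ← hgen, Algebra.adjoin_eq_span, Submodule.span_le]
  intro g hg
  obtain ⟨n, I, J, rfl⟩ : ∃ (n : ℕ) (I J : Fin n → Fin N), g = wordProd x I J := by
    induction hg using Submonoid.closure_induction_left with
    | one => exact ⟨0, Fin.elim0, Fin.elim0, (wordProd_zero x _ _).symm⟩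
    | mul_left a ha b hb ih =>
      obtain ⟨⟨i, j⟩, rfl⟩ := ha
      obtain ⟨n, I, J, rfl⟩ := ih
      exact ⟨n + 1, Fin.cons i I, Fin.cons j J, (wordProd_cons x i j I J).symm⟩
  exact h n I J

/-- The span of the products of a reversed word in `y` and a word in `x`. -/
def wordSpan (F : Type*) {G : Type*} [Field F] [Ring G] [Algebra F G] {N : ℕ}
    (x y : Fin N → Fin N → G) : Submodule F G :=
  ⨆ (n : ℕ) (I : Fin n → Fin N) (K : Fin n → Fin N) (m : ℕ) (L : Fin m → Fin N)
    (J : Fin m → Fin N), F ∙ (wordProdRev y I K * wordProd x L J)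

lemma wordSpan_le {V : Submodule F G} : wordSpan F x y ≤ V ↔
    ∀ n (I K : Fin n → Fin N) m (L J : Fin m → Fin N),
      wordProdRev y I K * wordProd x L J ∈ V := by
  simp only [wordSpan, iSup_le_iff, Submodule.span_singleton_le_iff_mem]

lemma mem_wordSpan (I K : Fin n → Fin N) (L J : Fin m → Fin N) :
    wordProdRev y I K * wordProd x L J ∈ wordSpan F x y :=
  wordSpan_le.1 le_rfl n I K m L J

lemma left_mul_mem_wordSpan (i j : Fin N) {g : G} (hg : g ∈ wordSpan F x y) :
    y i j * g ∈ wordSpan F x y := by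
  suffices h : wordSpan F x y ≤ (wordSpan F x y).comap (LinearMap.mulLeft F (y i j)) from h hg
  refine wordSpan_le.2 fun n I K m L J => ?_
  rw [Submodule.mem_comap, LinearMap.mulLeft_apply, ← mul_assoc, ← wordProdRev_snoc]
  exact mem_wordSpan _ _ _ _

lemma wordProdRev_mul_mem_wordSpan (I K : Fin n → Fin N) {g : G} (hg : g ∈ wordSpan F x y) :
    wordProdRev y I K * g ∈ wordSpan F x y := by
  induction n with
  | zero => simpa [wordProdRev_zero] using hg
  | succ n ih =>
    rw [← Fin.snoc_init_self I, ← Fin.snoc_init_self K, wordProdRev_snoc, mul_assoc]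
    exact left_mul_mem_wordSpan _ _ (ih _ _)

lemma IsQuantumMatrix.mul_mem_wordSpan {q : F} (hx : IsQuantumMatrix q x) (hq : q ≠ 0)
    (hxy : ∀ i j, ∑ k, x i k * y k j = if i = j then 1 else 0)
    (hyx : ∀ i j, ∑ k, y i k * x k j = if i = j then 1 else 0) (i j : Fin N) {g : G}
    (hg : g ∈ wordSpan F x y) : x i j * g ∈ wordSpan F x y := by
  suffices h : ∀ (n : ℕ) (I K : Fin n → Fin N) (m : ℕ) (L J : Fin m → Fin N) (i j : Fin N),
      x i j * (wordProdRev y I K * wordProd x L J) ∈ wordSpan F x y by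
    suffices h' : wordSpan F x y ≤ (wordSpan F x y).comap (LinearMap.mulLeft F (x i j)) from h' hg
    exact wordSpan_le.2 fun n I K m L J => h n I K m L J i j
  intro n
  induction n with
  | zero =>
    intro I K m L J i j
    rw [wordProdRev_zero, one_mul, ← wordProd_cons, ← one_mul (wordProd x _ _),
      ← wordProdRev_zero y I K]
    exact mem_wordSpan _ _ _ _
  | succ n ih =>
    intro I K m L J i j
    rw [← Fin.snoc_init_self I, ← Fin.snoc_init_self K, wordProdRev_snoc, mul_assoc, ← mul_assoc]
    generalize hz : wordProdRev y (Fin.init I) (Fin.init K) * wordProd x L J = z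
    have h1 := hx.mul_mem_of_exchange hq hxy hyx i j (I (Fin.last n)) (K (Fin.last n))
    suffices h2 : Submodule.span F (Set.range fun s : (Fin N × Fin N) × (Fin N × Fin N) =>
        y s.1.1 s.1.2 * x s.2.1 s.2.2) ≤ (wordSpan F x y).comap (LinearMap.mulRight F z) from h2 h1
    rw [Submodule.span_le]
    rintro _ ⟨⟨⟨a, b⟩, c, d⟩, rfl⟩
    simp only [Submodule.comap_coe, Set.mem_preimage, LinearMap.mulRight_apply, SetLike.mem_coe,
      mul_assoc]
    exact left_mul_mem_wordSpan _ _ (hz ▸ ih _ _ _ _ _ _ _)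

lemma IsQuantumMatrix.wordSpan_eq_top {F G : Type} [Field F] [Ring G] [Algebra F G] {N : ℕ}
    {q : F} {x y : Fin N → Fin N → G} (hx : IsQuantumMatrix q x) (hq : q ≠ 0)
    (hq2 : q + q⁻¹ ≠ 0)
    (hxy : ∀ i j, ∑ k, x i k * y k j = if i = j then 1 else 0)
    (hyx : ∀ i j, ∑ k, y i k * x k j = if i = j then 1 else 0)
    {D : G} (hD : qdet q x * D = 1)
    (hgen : Algebra.adjoin F ((Set.range fun p : Fin N × Fin N => x p.1 p.2) ∪ {D}) = ⊤) :
    wordSpan F x y = ⊤ := by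
  rw [eq_top_iff, ← Algebra.top_toSubmodule, ← hgen, Algebra.adjoin_eq_span, Submodule.span_le]
  intro g hg
  induction hg using Submonoid.closure_induction_left with
  | one =>
    have := mem_wordSpan (F := F) (x := x) (y := y) (N := N) (n := 0) (m := 0) Fin.elim0 Fin.elim0
      Fin.elim0 Fin.elim0
    simpa [wordProd_zero, wordProdRev_zero] using this
  | mul_left a ha b hb ih =>
    rcases ha with ⟨⟨i, j⟩, rfl⟩ | rfl
    · exact hx.mul_mem_wordSpan hq hxy hyx i j ih
    · obtain ⟨t, r, h⟩ := hx.eq_of_qdet_mul_eq_one hq hq2 hyx hD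
      rw [h, SetLike.mem_coe, Finset.sum_mul]
      refine Submodule.sum_mem _ fun I _ => ?_
      rw [smul_mul_assoc]
      exact Submodule.smul_mem _ _ (wordProdRev_mul_mem_wordSpan _ _ ih)

end Generation

section Weights

variable {N n m : ℕ}

lemma exists_perm_of_card_fiber_eq {α : Type*} [DecidableEq α] {K L : Fin n → α}
    (h : ∀ i, Fintype.card {s // K s = i} = Fintype.card {s // L s = i}) :
    ∃ σ : Equiv.Perm (Fin n), L = K ∘ σ :=
  ⟨Equiv.ofFiberEquiv fun i => Fintype.equivOfCardEq (h i).symm,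
    funext fun s => (Equiv.ofFiberEquiv_map _ s).symm⟩

lemma eq_of_card_fiber_eq {K : Fin n → Fin N} {L : Fin m → Fin N}
    (h : ∀ i, Fintype.card {s // K s = i} = Fintype.card {s // L s = i}) : n = m := by
  have hn := Fintype.card_congr (Equiv.sigmaFiberEquiv K)
  have hm := Fintype.card_congr (Equiv.sigmaFiberEquiv L)
  rw [Fintype.card_sigma, Fintype.card_fin] at hn hm
  rw [← hn, ← hm]
  exact Finset.sum_congr rfl fun i _ => h i

lemma exists_weight_functional {F D : Type} [Field F] [CommRing D] [Algebra F D] (t : Fin N → Dˣ)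
    (hfree : ∀ (B : Type) [CommRing B] [Algebra F B] (u : Fin N → Bˣ),
      ∃! φ : D →ₐ[F] B, ∀ i, φ (t i : D) = (u i : B)) :
    ∃ p : D →ₗ[F] F, ∀ (n m : ℕ) (K : Fin n → Fin N) (L : Fin m → Fin N),
      p (((∏ s, (t (K s))⁻¹) * ∏ s, t (L s) : Dˣ) : D) =
        if ∀ i, Fintype.card {s // K s = i} = Fintype.card {s // L s = i} then 1 else 0 := by
  let w : Multiplicative (Fin N → ℤ) →* (AddMonoidAlgebra F (Fin N → ℤ))ˣ :=
    (Units.map (AddMonoidAlgebra.of F (Fin N → ℤ))).comp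
      (toUnits (G := Multiplicative (Fin N → ℤ))).toMonoidHom
  obtain ⟨φ, hφ, -⟩ := hfree (AddMonoidAlgebra F (Fin N → ℤ))
    fun i => w (Multiplicative.ofAdd (Pi.single i 1))
  have hφ' : ∀ i, Units.map φ.toMonoidHom (t i) = w (Multiplicative.ofAdd (Pi.single i 1)) :=
    fun i => Units.ext (hφ i)
  obtain ⟨c, hc⟩ : ∃ c : AddMonoidAlgebra F (Fin N → ℤ) →ₗ[F] F,
      ∀ a, c (AddMonoidAlgebra.single a 1) = if a = 0 then 1 else 0 :=
    ⟨{ toFun := fun f => f.coeff 0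
       map_add' := fun f g => by rw [AddMonoidAlgebra.coeff_add, Finsupp.add_apply]
       map_smul' := fun a f => by
        rw [AddMonoidAlgebra.coeff_smul, Finsupp.smul_apply, RingHom.id_apply] },
      fun a => by
        change (AddMonoidAlgebra.single a (1 : F)).coeff 0 = _
        rw [AddMonoidAlgebra.coeff_single, Finsupp.single_apply]⟩
  refine ⟨c ∘ₗ φ.toLinearMap, fun n m K L => ?_⟩
  have h1 : Units.map φ.toMonoidHom ((∏ s, (t (K s))⁻¹) * ∏ s, t (L s)) =
      w (Multiplicative.ofAdd (-(∑ s, Pi.single (K s) 1) + ∑ s, Pi.single (L s) 1)) := by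
    simp only [map_mul, map_prod, map_inv, hφ', ofAdd_add, ofAdd_neg, ofAdd_sum,
      Finset.prod_inv_distrib]
  have h2 : φ (((∏ s, (t (K s))⁻¹) * ∏ s, t (L s) : Dˣ) : D) =
      AddMonoidAlgebra.single (-(∑ s, Pi.single (K s) 1) + ∑ s, Pi.single (L s) 1) 1 :=
    congrArg Units.val h1
  have h3 : ∀ {l : ℕ} (K : Fin l → Fin N) (i : Fin N),
      (∑ s, Pi.single (K s) (1 : ℤ) : Fin N → ℤ) i = Fintype.card {s // K s = i} := by
    intro l K i
    simp [Finset.sum_apply, Pi.single_apply, Fintype.card_subtype, eq_comm]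
  have h4 : (-(∑ s, Pi.single (K s) 1) + ∑ s, Pi.single (L s) 1 : Fin N → ℤ) = 0 ↔
      ∀ i, Fintype.card {s // K s = i} = Fintype.card {s // L s = i} := by
    simp only [neg_add_eq_zero, funext_iff, h3, Nat.cast_inj]
  rw [LinearMap.comp_apply, AlgHom.toLinearMap_apply, h2, hc]
  exact if_congr h4 rfl rfl

end Weights

section Hopf

lemma eq_of_sum_mul_eq {ι G : Type*} [Fintype ι] [DecidableEq ι] [Ring G] {A B C : ι → ι → G}
    (hAB : ∀ i j, ∑ k, A i k * B k j = if i = j then 1 else 0)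
    (hBC : ∀ i j, ∑ k, B i k * C k j = if i = j then 1 else 0) (i j : ι) : A i j = C i j := by
  have h1 : Matrix.of A * Matrix.of B = 1 := by
    ext i j; simpa [Matrix.mul_apply, Matrix.one_apply] using hAB i j
  have h2 : Matrix.of B * Matrix.of C = 1 := by
    ext i j; simpa [Matrix.mul_apply, Matrix.one_apply] using hBC i j
  have h : Matrix.of A = Matrix.of C := left_inv_eq_right_inv h1 h2
  exact congrFun (congrFun h i) j

lemma wordProd_ite {F : Type*} [CommSemiring F] {N n : ℕ} (a : Fin N → F) (K L : Fin n → Fin N) :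
    wordProd (fun i j => if i = j then a i else 0) K L =
      if K = L then ∏ s, a (K s) else 0 := by
  rw [wordProd, List.prod_ofFn]
  split_ifs with h
  · subst h; simp
  · obtain ⟨s, hs⟩ := Function.ne_iff.1 h
    exact Finset.prod_eq_zero (Finset.mem_univ s) (if_neg hs)

variable {F M G D : Type} [Field F] [Ring M] [Algebra F M] [Ring G] [Algebra F G]
  [CommRing D] [Algebra F D] {N n m : ℕ}

lemma comul_wordProd {x : Fin N → Fin N → M} {Δ : M →ₐ[F] M ⊗[F] M}
    (hΔ : ∀ i j, Δ (x i j) = ∑ k, x i k ⊗ₜ[F] x k j) (I J : Fin n → Fin N) :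
    Δ (wordProd x I J) = ∑ K, wordProd x I K ⊗ₜ[F] wordProd x K J := by
  induction n with
  | zero =>
    simp [wordProd_zero, Algebra.TensorProduct.one_def]
  | succ n ih =>
    rw [← Fin.cons_self_tail I, ← Fin.cons_self_tail J, sum_words_cons]
    simp only [wordProd_cons, map_mul, ih, hΔ, Finset.sum_mul_sum,
      Algebra.TensorProduct.tmul_mul_tmul]

variable {x : Fin N → Fin N → M} {ΔM : M →ₐ[F] M ⊗[F] M} {ΔG : G →ₐ[F] G ⊗[F] G}
  {ε : G →ₐ[F] F} {ι : M →ₐ[F] G} {S : G →ₗ[F] G}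

lemma counit_wordProd (hε : ∀ i j, ε (ι (x i j)) = if i = j then 1 else 0)
    (I J : Fin n → Fin N) : ε (ι (wordProd x I J)) = if I = J then 1 else 0 := by
  rw [map_wordProd, map_wordProd]
  simp only [hε, wordProd_ite (fun _ => (1 : F)), Finset.prod_const_one]

lemma sum_antipode_mul (hΔM : ∀ i j, ΔM (x i j) = ∑ k, x i k ⊗ₜ[F] x k j)
    (hΔG : ∀ m, ΔG (ι m) = Algebra.TensorProduct.map ι ι (ΔM m))
    (hε : ∀ i j, ε (ι (x i j)) = if i = j then 1 else 0)
    (hS : LinearMap.mul' F G ∘ₗ TensorProduct.map S LinearMap.id ∘ₗ ΔG.toLinearMap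
      = Algebra.linearMap F G ∘ₗ ε.toLinearMap) (I J : Fin n → Fin N) :
    ∑ K, S (ι (wordProd x I K)) * ι (wordProd x K J) = if I = J then 1 else 0 := by
  have h := LinearMap.congr_fun hS (ι (wordProd x I J))
  simp only [LinearMap.comp_apply, AlgHom.toLinearMap_apply, hΔG, comul_wordProd hΔM, map_sum,
    Algebra.TensorProduct.map_tmul, TensorProduct.map_tmul, LinearMap.mul'_apply,
    LinearMap.id_apply, counit_wordProd hε, Algebra.linearMap_apply] at h
  rw [h]
  split_ifs <;> simp

lemma sum_mul_antipode (hΔM : ∀ i j, ΔM (x i j) = ∑ k, x i k ⊗ₜ[F] x k j)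
    (hΔG : ∀ m, ΔG (ι m) = Algebra.TensorProduct.map ι ι (ΔM m))
    (hε : ∀ i j, ε (ι (x i j)) = if i = j then 1 else 0)
    (hS : LinearMap.mul' F G ∘ₗ TensorProduct.map LinearMap.id S ∘ₗ ΔG.toLinearMap
      = Algebra.linearMap F G ∘ₗ ε.toLinearMap) (i j : Fin N) :
    ∑ k, ι (x i k) * S (ι (x k j)) = if i = j then 1 else 0 := by
  have h := LinearMap.congr_fun hS (ι (x i j))
  simp only [LinearMap.comp_apply, AlgHom.toLinearMap_apply, hΔG, hΔM, map_sum,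
    Algebra.TensorProduct.map_tmul, TensorProduct.map_tmul, LinearMap.mul'_apply,
    LinearMap.id_apply, hε, Algebra.linearMap_apply] at h
  rw [h]
  split_ifs <;> simp

lemma sum_antipode_mul_generator (hΔM : ∀ i j, ΔM (x i j) = ∑ k, x i k ⊗ₜ[F] x k j)
    (hΔG : ∀ m, ΔG (ι m) = Algebra.TensorProduct.map ι ι (ΔM m))
    (hε : ∀ i j, ε (ι (x i j)) = if i = j then 1 else 0)
    (hS : LinearMap.mul' F G ∘ₗ TensorProduct.map S LinearMap.id ∘ₗ ΔG.toLinearMap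
      = Algebra.linearMap F G ∘ₗ ε.toLinearMap) (i j : Fin N) :
    ∑ k, S (ι (x i k)) * ι (x k j) = if i = j then 1 else 0 := by
  have h := LinearMap.congr_fun hS (ι (x i j))
  simp only [LinearMap.comp_apply, AlgHom.toLinearMap_apply, hΔG, hΔM, map_sum,
    Algebra.TensorProduct.map_tmul, TensorProduct.map_tmul, LinearMap.mul'_apply,
    LinearMap.id_apply, hε, Algebra.linearMap_apply] at h
  rw [h]
  split_ifs <;> simp

lemma antipode_wordProd (hΔM : ∀ i j, ΔM (x i j) = ∑ k, x i k ⊗ₜ[F] x k j)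
    (hΔG : ∀ m, ΔG (ι m) = Algebra.TensorProduct.map ι ι (ΔM m))
    (hε : ∀ i j, ε (ι (x i j)) = if i = j then 1 else 0)
    (hS : LinearMap.mul' F G ∘ₗ TensorProduct.map S LinearMap.id ∘ₗ ΔG.toLinearMap
      = Algebra.linearMap F G ∘ₗ ε.toLinearMap)
    (hS' : LinearMap.mul' F G ∘ₗ TensorProduct.map LinearMap.id S ∘ₗ ΔG.toLinearMap
      = Algebra.linearMap F G ∘ₗ ε.toLinearMap) (I J : Fin n → Fin N) :
    S (ι (wordProd x I J)) = wordProdRev (fun i j => S (ι (x i j))) I J :=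
  eq_of_sum_mul_eq (A := fun I J : Fin n → Fin N => S (ι (wordProd x I J)))
    (B := fun I J => ι (wordProd x I J)) (sum_antipode_mul hΔM hΔG hε hS)
    (fun I J => by
      simp only [map_wordProd]
      exact sum_wordProd_mul_wordProdRev (sum_mul_antipode hΔM hΔG hε hS') I J) I J

lemma coorbit_wordProd (hΔM : ∀ i j, ΔM (x i j) = ∑ k, x i k ⊗ₜ[F] x k j)
    (hS : ∀ I J : Fin n → Fin N,
      S (ι (wordProd x I J)) = wordProdRev (fun i j => S (ι (x i j))) I J)
    (e : M →ₐ[F] F) (I J : Fin n → Fin N) :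
    coorbit e (adjBeta ΔM ι S) (wordProd x I J) =
      wordComb (fun i j => ι (x i j)) (fun i j => S (ι (x i j)))
        (fun K L => wordProd (fun i j => e (x i j)) K L) I J := by
  simp only [coorbit, adjBeta, LinearMap.comp_apply, AlgHom.toLinearMap_apply,
    comul_wordProd hΔM, map_sum, TensorProduct.map_tmul, TensorProduct.sum_tmul,
    LinearMap.id_apply, LinearEquiv.coe_coe, TensorProduct.comm_tmul, TensorProduct.assoc_tmul,
    LinearMap.mul'_apply, TensorProduct.lid_tmul, hS, wordComb, ← map_wordProd]
  exact Finset.sum_comm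

/-- The left coaction of the torus as an algebra homomorphism. -/
def leftCoactHom (π : G →ₐ[F] D) (ΔG : G →ₐ[F] G ⊗[F] G) : G →ₐ[F] D ⊗[F] G :=
  (Algebra.TensorProduct.map π (AlgHom.id F G)).comp ΔG

lemma leftCoactHom_generator (hΔM : ∀ i j, ΔM (x i j) = ∑ k, x i k ⊗ₜ[F] x k j)
    (hΔG : ∀ m, ΔG (ι m) = Algebra.TensorProduct.map ι ι (ΔM m)) {π : G →ₐ[F] D} {t : Fin N → Dˣ}
    (hπ : ∀ i j, π (ι (x i j)) = if i = j then (t i : D) else 0) (i j : Fin N) :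
    leftCoactHom π ΔG (ι (x i j)) = (t i : D) ⊗ₜ[F] ι (x i j) := by
  simp only [leftCoactHom, AlgHom.comp_apply, hΔG, hΔM, map_sum, Algebra.TensorProduct.map_tmul,
    hπ, AlgHom.id_apply, TensorProduct.ite_tmul, Finset.sum_ite_eq,
    Finset.mem_univ, if_true]

variable {x y : Fin N → Fin N → G} {t : Fin N → Dˣ} {lam : G →ₐ[F] D ⊗[F] G}

lemma map_inverse_generator (hx : ∀ i j, lam (x i j) = (t i : D) ⊗ₜ[F] x i j)
    (hxy : ∀ i j, ∑ k, x i k * y k j = if i = j then 1 else 0)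
    (hyx : ∀ i j, ∑ k, y i k * x k j = if i = j then 1 else 0) (i j : Fin N) :
    lam (y i j) = ((t j)⁻¹ : Dˣ).1 ⊗ₜ[F] y i j := by
  refine eq_of_sum_mul_eq (A := fun i j => lam (y i j)) (B := fun i j => lam (x i j))
    (C := fun i j => ((t j)⁻¹ : Dˣ).1 ⊗ₜ[F] y i j) (fun i j => ?_) (fun i j => ?_) i j
  · simp only [← map_mul, ← map_sum, hyx]
    split_ifs <;> simp
  · simp only [hx, Algebra.TensorProduct.tmul_mul_tmul, ← TensorProduct.tmul_sum, hxy]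
    split_ifs with h
    · simp [h, Algebra.TensorProduct.one_def]
    · simp

lemma map_wordProd_eq_tmul (hx : ∀ i j, lam (x i j) = (t i : D) ⊗ₜ[F] x i j)
    (L J : Fin m → Fin N) :
    lam (wordProd x L J) = ((∏ s, t (L s) : Dˣ) : D) ⊗ₜ[F] wordProd x L J := by
  induction m with
  | zero => simp [wordProd_zero, Algebra.TensorProduct.one_def]
  | succ m ih =>
    rw [wordProd_succ, map_mul, hx, ih, Algebra.TensorProduct.tmul_mul_tmul, Fin.prod_univ_succ,
      Units.val_mul]
    rfl

lemma map_wordProdRev_eq_tmul (hy : ∀ i j, lam (y i j) = ((t j)⁻¹ : Dˣ).1 ⊗ₜ[F] y i j)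
    (I K : Fin n → Fin N) :
    lam (wordProdRev y I K) = ((∏ s, (t (K s))⁻¹ : Dˣ) : D) ⊗ₜ[F] wordProdRev y I K := by
  induction n with
  | zero => simp [wordProdRev_zero, Algebra.TensorProduct.one_def]
  | succ n ih =>
    rw [← Fin.cons_self_tail I, ← Fin.cons_self_tail K, wordProdRev_cons, map_mul, hy, ih,
      Algebra.TensorProduct.tmul_mul_tmul, Fin.prod_univ_succ, mul_comm ((t _)⁻¹), Units.val_mul]
    rfl

lemma map_wordProdRev_mul_wordProd (hx : ∀ i j, lam (x i j) = (t i : D) ⊗ₜ[F] x i j)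
    (hy : ∀ i j, lam (y i j) = ((t j)⁻¹ : Dˣ).1 ⊗ₜ[F] y i j)
    (I K : Fin n → Fin N) (L J : Fin m → Fin N) :
    lam (wordProdRev y I K * wordProd x L J) =
      (((∏ s, (t (K s))⁻¹) * ∏ s, t (L s) : Dˣ) : D) ⊗ₜ[F]
        (wordProdRev y I K * wordProd x L J) := by
  rw [map_mul, map_wordProd_eq_tmul hx, map_wordProdRev_eq_tmul hy,
    Algebra.TensorProduct.tmul_mul_tmul, Units.val_mul]

lemma exists_coinvariant_projection (hx : ∀ i j, lam (x i j) = (t i : D) ⊗ₜ[F] x i j)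
    (hy : ∀ i j, lam (y i j) = ((t j)⁻¹ : Dˣ).1 ⊗ₜ[F] y i j)
    (hfree : ∀ (B : Type) [CommRing B] [Algebra F B] (u : Fin N → Bˣ),
      ∃! φ : D →ₐ[F] B, ∀ i, φ (t i : D) = (u i : B)) :
    ∃ P : G →ₗ[F] G, (∀ f, lam f = 1 ⊗ₜ[F] f → P f = f) ∧
      ∀ (n m : ℕ) (I K : Fin n → Fin N) (L J : Fin m → Fin N),
        P (wordProdRev y I K * wordProd x L J) =
          if ∀ i, Fintype.card {s // K s = i} = Fintype.card {s // L s = i} then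
            wordProdRev y I K * wordProd x L J else 0 := by
  obtain ⟨p, hp⟩ := exists_weight_functional t hfree
  refine ⟨(TensorProduct.lid F G).toLinearMap ∘ₗ TensorProduct.map p LinearMap.id ∘ₗ
    lam.toLinearMap, fun f hf => ?_, fun n m I K L J => ?_⟩
  · have h1 : p 1 = 1 := by simpa using hp 0 0 Fin.elim0 Fin.elim0
    simp [hf, h1]
  · simp only [LinearMap.comp_apply, AlgHom.toLinearMap_apply,
      map_wordProdRev_mul_wordProd hx hy, TensorProduct.map_tmul, hp, LinearMap.id_apply,
      LinearEquiv.coe_coe, TensorProduct.lid_tmul, ite_smul, one_smul, zero_smul]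

end Hopf

section Coorbit

variable {F M G D : Type} [Field F] [Ring M] [Algebra F M] [Ring G] [Algebra F G]
  [CommRing D] [Algebra F D] {N n : ℕ} {x : Fin N → Fin N → M} {ΔM : M →ₐ[F] M ⊗[F] M}
  {ι : M →ₐ[F] G} {S : G →ₗ[F] G} {e : M →ₐ[F] F} {q : F}

lemma IsQuantumMatrix.map (hx : IsQuantumMatrix q x) (ι : M →ₐ[F] G) :
    IsQuantumMatrix q fun i j => ι (x i j) where
  row i j l h := by simp only [← map_mul, ← map_smul, hx.row i j l h]
  col i k j h := by simp only [← map_mul, ← map_smul, hx.col i k j h]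
  anti i k j l h h' := by simp only [← map_mul, hx.anti i k j l h h']
  diag i k j l h h' := by simp only [← map_mul, ← map_sub, ← map_smul, hx.diag i k j l h h']

lemma map_qdet (ι : M →ₐ[F] G) (q : F) (x : Fin N → Fin N → M) :
    ι (qdet q x) = qdet q fun i j => ι (x i j) := by
  simp only [qdet_eq_sum, map_sum, map_smul, map_wordProd]

lemma one_mem_range_coorbit (hΔM : ∀ i j, ΔM (x i j) = ∑ k, x i k ⊗ₜ[F] x k j)
    (hS : ∀ (n : ℕ) (I J : Fin n → Fin N),
      S (ι (wordProd x I J)) = wordProdRev (fun i j => S (ι (x i j))) I J) :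
    1 ∈ LinearMap.range (coorbit e (adjBeta ΔM ι S)) := by
  refine ⟨wordProd x Fin.elim0 Fin.elim0, ?_⟩
  rw [coorbit_wordProd hΔM (hS 0)]
  simp [wordComb, wordProd_zero, wordProdRev_zero]

lemma sum_smul_mem_range_coorbit (hΔM : ∀ i j, ΔM (x i j) = ∑ k, x i k ⊗ₜ[F] x k j)
    (hS : ∀ (n : ℕ) (I J : Fin n → Fin N),
      S (ι (wordProd x I J)) = wordProdRev (fun i j => S (ι (x i j))) I J)
    (hgen : Algebra.adjoin F (Set.range fun p : Fin N × Fin N => x p.1 p.2) = ⊤)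
    {b : Fin N → F} (he : ∀ i j, e (x i j) = if i = j then b i else 0)
    {f : G} (hf : f ∈ LinearMap.range (coorbit e (adjBeta ΔM ι S))) (i j : Fin N) :
    ∑ l, b l • (S (ι (x i l)) * f * ι (x l j)) ∈
      LinearMap.range (coorbit e (adjBeta ΔM ι S)) := by
  obtain ⟨h, rfl⟩ := hf
  let T : G →ₗ[F] G := ∑ l, b l • (LinearMap.mulRight F (ι (x l j)) ∘ₗ
    LinearMap.mulLeft F (S (ι (x i l))))
  have hT : ∀ g, T g = ∑ l, b l • (S (ι (x i l)) * g * ι (x l j)) := fun g => by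
    simp [T, LinearMap.sum_apply]
  rw [← hT]
  suffices (LinearMap.range (coorbit e (adjBeta ΔM ι S))).comap
      (T ∘ₗ coorbit e (adjBeta ΔM ι S)) = ⊤ from this.ge (Submodule.mem_top (x := h))
  refine eq_top_of_wordProd_mem hgen fun n I J => ?_
  refine ⟨wordProd x (Fin.snoc I i : Fin (n + 1) → Fin N) (Fin.snoc J j), ?_⟩
  simp only [LinearMap.comp_apply, coorbit_wordProd hΔM (hS _), hT, he, wordProd_ite]
  have := wordComb_snoc (x := fun i j => ι (x i j)) (y := fun i j => S (ι (x i j))) b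
    (fun K L => if K = L then ∏ s, b (K s) else 0) (Fin.snoc I i) (Fin.snoc J j)
  simp only [Fin.snoc_last, Fin.init_snoc] at this
  rw [← this]
  congr 1
  funext K L
  rw [Fin.prod_univ_castSucc]
  by_cases h1 : K (Fin.last n) = L (Fin.last n) <;> by_cases h2 : Fin.init K = Fin.init L
  · have : K = L := by rw [← Fin.snoc_init_self K, ← Fin.snoc_init_self L, h1, h2]
    simp [this, Fin.init]
  · have : K ≠ L := fun h => h2 (h ▸ rfl)
    simp [this, h2]
  all_goals
    have : K ≠ L := fun h => h1 (h ▸ rfl)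
    simp [this, h1]

lemma map_coorbit_eq_tmul {lam : G →ₐ[F] D ⊗[F] G} {t : Fin N → Dˣ}
    (hΔM : ∀ i j, ΔM (x i j) = ∑ k, x i k ⊗ₜ[F] x k j)
    (hS : ∀ (n : ℕ) (I J : Fin n → Fin N),
      S (ι (wordProd x I J)) = wordProdRev (fun i j => S (ι (x i j))) I J)
    (hgen : Algebra.adjoin F (Set.range fun p : Fin N × Fin N => x p.1 p.2) = ⊤)
    {b : Fin N → F} (he : ∀ i j, e (x i j) = if i = j then b i else 0)
    (hx : ∀ i j, lam (ι (x i j)) = (t i : D) ⊗ₜ[F] ι (x i j))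
    (hy : ∀ i j, lam (S (ι (x i j))) = ((t j)⁻¹ : Dˣ).1 ⊗ₜ[F] S (ι (x i j))) (h : M) :
    lam (coorbit e (adjBeta ΔM ι S) h) = 1 ⊗ₜ[F] coorbit e (adjBeta ΔM ι S) h := by
  suffices LinearMap.eqLocus (lam.toLinearMap ∘ₗ coorbit e (adjBeta ΔM ι S))
      (TensorProduct.mk F D G 1 ∘ₗ coorbit e (adjBeta ΔM ι S)) = ⊤ from
    this.ge (Submodule.mem_top (x := h))
  refine eq_top_of_wordProd_mem hgen fun n I J => ?_
  simp only [LinearMap.mem_eqLocus, LinearMap.comp_apply, AlgHom.toLinearMap_apply,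
    TensorProduct.mk_apply, coorbit_wordProd hΔM (hS _), wordComb, he, wordProd_ite, ite_smul,
    zero_smul, Finset.sum_ite_eq, Finset.mem_univ, if_true, map_sum, map_smul,
    map_wordProdRev_mul_wordProd (x := fun i j => ι (x i j)) (y := fun i j => S (ι (x i j))) hx hy,
    Finset.prod_inv_distrib, inv_mul_cancel, Units.val_one]

end Coorbit

section LaurentPoints

open Polynomial LaurentPolynomial

lemma exists_polynomial_smul_eq {k F : Type*} [Field k] [Field F] [Algebra k F] {N : ℕ}
    [Algebra k[X] F] [IsScalarTower k k[X] F]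
    {η : k[T;T⁻¹] →ₐ[k] k} (hη : η (T 1) = 1) {θ : k[T;T⁻¹] →ₐ[k] F}
    (hθ : θ (T 1) = algebraMap k[X] F X) (ξ : Fin N → k[T;T⁻¹]) :
    ∃ (m : ℕ) (a : Fin N → k[X]), ∀ i,
      algebraMap k[X] F (a i) = algebraMap k[X] F X ^ m * θ (ξ i) ∧ (a i).eval 1 = η (ξ i) := by
  have hη' : ∀ p : k[X], η (toLaurent p) = p.eval 1 := fun p => by
    have : η.comp toLaurentAlg = aeval (1 : k) := by
      ext
      simp [hη]
    simpa [aeval_def, eval₂_eq_eval_map] using DFunLike.congr_fun this p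
  have hθ' : ∀ p : k[X], θ (toLaurent p) = algebraMap k[X] F p := fun p => by
    have : θ.comp toLaurentAlg = IsScalarTower.toAlgHom k k[X] F := by
      ext
      simp [hθ]
    simpa using DFunLike.congr_fun this p
  choose n f hf using fun i => exists_T_pow (ξ i)
  have hT : ∀ m : ℕ, (T m : k[T;T⁻¹]) = T 1 ^ m := fun m => by simp [T_pow]
  refine ⟨∑ i, n i, fun i => f i * X ^ (∑ j, n j - n i), fun i => ?_⟩
  have hn : n i + (∑ j, n j - n i) = ∑ j, n j :=
    Nat.add_sub_cancel' (Finset.single_le_sum (f := n) (fun _ _ => Nat.zero_le _)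
      (Finset.mem_univ i))
  constructor
  · rw [map_mul, ← hθ', hf, map_mul, hT, map_pow, hθ, map_pow, mul_assoc, ← pow_add, hn, mul_comm]
  · rw [eval_mul, ← hη', hf, map_mul, hT, map_pow, hη]
    simp

end LaurentPoints

section Main

open Polynomial

variable {k F G : Type} [Field k] [Field F] [Algebra k[X] F] [FaithfulSMul k[X] F]
  [Ring G] [Algebra F G] {N : ℕ}

lemma IsOrbitSubmodule.mem_of_projection {a : Fin N → k[X]} {x y : Fin N → Fin N → G}
    {V : Submodule F G} (h : IsOrbitSubmodule a x y V)
    (ha : Function.Injective fun i => (a i).eval 1) (htop : wordSpan F x y = ⊤)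
    {P : G →ₗ[F] G} (hP : ∀ f ∈ V, P f = f)
    (hPw : ∀ (n m : ℕ) (I K : Fin n → Fin N) (L J : Fin m → Fin N),
        P (wordProdRev y I K * wordProd x L J) =
          if ∀ i, Fintype.card {s // K s = i} = Fintype.card {s // L s = i} then
            wordProdRev y I K * wordProd x L J else 0) {f : G} (hf : P f = f) : f ∈ V := by
  have hle : wordSpan F x y ≤ V.comap P := by
    refine wordSpan_le.2 fun n I K m L J => ?_
    rw [Submodule.mem_comap, hPw]
    split_ifs with hc
    · obtain rfl := eq_of_card_fiber_eq hc
      obtain ⟨σ, rfl⟩ := exists_perm_of_card_fiber_eq hc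
      refine h.wordProdRev_mul_wordProd_mem ha P hP (fun I K L J hL => ?_) (fun I K L J hL => ?_)
        I K J σ
      · obtain ⟨σ, rfl⟩ := hL
        exact (hPw _ _ _ _ _ _).trans (if_pos fun i => Fintype.card_congr
          (σ.subtypeEquiv fun s => by simp).symm)
      · exact (hPw _ _ _ _ _ _).trans (if_neg fun hc => hL (exists_perm_of_card_fiber_eq hc))
    · exact V.zero_mem
  rw [← hf]
  exact hle (htop.ge Submodule.mem_top)

end Main

/-- Generic case: for diagonal `ξ` with `η(ξ)` having pairwise different eigenvalues,
the image of `β^ξ` over `K(q)` is the whole quantum quotient space `O(D\GL_q)`. -/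
theorem image_coorbit_generic
    (K : Subfield ℂ) {N : ℕ}
    (η : LaurentPolynomial ↥K →ₐ[↥K] ↥K)
    (hη : η (LaurentPolynomial.T 1) = 1)
    (θ : LaurentPolynomial ↥K →ₐ[↥K] RatFunc ↥K)
    (hθ : θ (LaurentPolynomial.T 1) = RatFunc.X)
    (Mq Gq : Type) [Ring Mq] [Algebra (RatFunc ↥K) Mq] [Ring Gq] [Algebra (RatFunc ↥K) Gq]
    (xq : Fin N → Fin N → Mq)
    (hrowq : ∀ i j l : Fin N, j < l → xq i j * xq i l = ((RatFunc.X : RatFunc ↥K)) • (xq i l * xq i j))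
    (hcolq : ∀ i k j : Fin N, i < k → xq i j * xq k j = ((RatFunc.X : RatFunc ↥K)) • (xq k j * xq i j))
    (hantiq : ∀ i k j l : Fin N, i < k → j < l → xq i l * xq k j = xq k j * xq i l)
    (hdiagq : ∀ i k j l : Fin N, i < k → j < l →
      xq i j * xq k l - xq k l * xq i j = (((RatFunc.X : RatFunc ↥K)) - ((RatFunc.X : RatFunc ↥K)⁻¹)) • (xq i l * xq k j))
    (hgenq : Algebra.adjoin (RatFunc ↥K) (Set.range fun p : Fin N × Fin N => xq p.1 p.2) = ⊤)
    (hfreeq : ∀ (B : Type) [Ring B] [Algebra (RatFunc ↥K) B] (y : Fin N → Fin N → B),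
      (∀ i j l : Fin N, j < l → y i j * y i l = ((RatFunc.X : RatFunc ↥K)) • (y i l * y i j)) →
      (∀ i k j : Fin N, i < k → y i j * y k j = ((RatFunc.X : RatFunc ↥K)) • (y k j * y i j)) →
      (∀ i k j l : Fin N, i < k → j < l → y i l * y k j = y k j * y i l) →
      (∀ i k j l : Fin N, i < k → j < l →
        y i j * y k l - y k l * y i j = (((RatFunc.X : RatFunc ↥K)) - ((RatFunc.X : RatFunc ↥K)⁻¹)) • (y i l * y k j)) →
      ∃! φ : Mq →ₐ[(RatFunc ↥K)] B, ∀ i j, φ (xq i j) = y i j)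
    (ιq : Mq →ₐ[(RatFunc ↥K)] Gq) (dInvq : Gq)
    (hd1q : ιq (qdet ((RatFunc.X : RatFunc ↥K)) xq) * dInvq = 1)
    (hd2q : dInvq * ιq (qdet ((RatFunc.X : RatFunc ↥K)) xq) = 1)
    (hgenGq : Algebra.adjoin (RatFunc ↥K)
      (Set.range (fun p : Fin N × Fin N => ιq (xq p.1 p.2)) ∪ {dInvq}) = ⊤)
    (hfreeGq : ∀ (B : Type) [Ring B] [Algebra (RatFunc ↥K) B] (φ : Mq →ₐ[(RatFunc ↥K)] B) (u : B),
      φ (qdet ((RatFunc.X : RatFunc ↥K)) xq) * u = 1 → u * φ (qdet ((RatFunc.X : RatFunc ↥K)) xq) = 1 →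
      ∃! ψ : Gq →ₐ[(RatFunc ↥K)] B, ψ.comp ιq = φ)
    (ΔMq : Mq →ₐ[(RatFunc ↥K)] Mq ⊗[(RatFunc ↥K)] Mq)
    (hΔMq : ∀ i j, ΔMq (xq i j) = ∑ k, xq i k ⊗ₜ[(RatFunc ↥K)] xq k j)
    (ΔGq : Gq →ₐ[(RatFunc ↥K)] Gq ⊗[(RatFunc ↥K)] Gq)
    (hΔGq : ∀ m, ΔGq (ιq m) = Algebra.TensorProduct.map ιq ιq (ΔMq m))
    (εGq : Gq →ₐ[(RatFunc ↥K)] (RatFunc ↥K))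
    (hεGq : ∀ i j, εGq (ιq (xq i j)) = if i = j then 1 else 0)
    (Stq : Gq →ₗ[(RatFunc ↥K)] Gq)
    (hS1q : LinearMap.mul' (RatFunc ↥K) Gq ∘ₗ TensorProduct.map Stq LinearMap.id ∘ₗ ΔGq.toLinearMap
      = Algebra.linearMap (RatFunc ↥K) Gq ∘ₗ εGq.toLinearMap)
    (hS2q : LinearMap.mul' (RatFunc ↥K) Gq ∘ₗ TensorProduct.map LinearMap.id Stq ∘ₗ ΔGq.toLinearMap
      = Algebra.linearMap (RatFunc ↥K) Gq ∘ₗ εGq.toLinearMap)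
    (Dq : Type) [CommRing Dq] [Algebra (RatFunc ↥K) Dq]
    (tq : Fin N → (Dq)ˣ)
    (πDq : Gq →ₐ[(RatFunc ↥K)] Dq)
    (hπDq : ∀ i j, πDq (ιq (xq i j)) = if i = j then (tq i : Dq) else 0)
    (hfreeDq : ∀ (B : Type) [CommRing B] [Algebra (RatFunc ↥K) B] (u : Fin N → Bˣ),
      ∃! φ : Dq →ₐ[(RatFunc ↥K)] B, ∀ i, φ (tq i : Dq) = (u i : B))
    (ξ : Matrix (Fin N) (Fin N) (LaurentPolynomial ↥K))
    (eq : Mq →ₐ[RatFunc ↥K] RatFunc ↥K) (heq : ∀ i l, eq (xq i l) = θ (ξ i l))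
    (hξdiag : ∀ i l, i ≠ l → ξ i l = 0)
    (hdist : ∀ i l, i ≠ l → η (ξ i i) ≠ η (ξ l l)) :
    Set.range ⇑(coorbit eq (adjBeta ΔMq ιq Stq)) = dCoinv πDq ΔGq := by
  have hX : algebraMap (Polynomial K) (RatFunc K) Polynomial.X = RatFunc.X :=
    RatFunc.algebraMap_X
  have hfaithful : FaithfulSMul (Polynomial K) (RatFunc K) :=
    (faithfulSMul_iff_algebraMap_injective _ _).2 (RatFunc.algebraMap_injective K)
  have hq : (RatFunc.X : RatFunc K) ≠ 0 := RatFunc.X_ne_zero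
  have hq2 : (RatFunc.X : RatFunc K) + RatFunc.X⁻¹ ≠ 0 := by
    intro h
    have h1 : (RatFunc.X : RatFunc K) ^ 2 + 1 = 0 := by
      field_simp at h
      simpa using h
    rw [← hX, ← map_pow, ← map_one (algebraMap (Polynomial K) (RatFunc K)), ← map_add,
      map_eq_zero_iff _ (RatFunc.algebraMap_injective K)] at h1
    exact (Polynomial.monic_X_pow_add_C (1 : K) two_ne_zero).ne_zero (by simpa using h1)
  have hx : IsQuantumMatrix RatFunc.X xq := ⟨hrowq, hcolq, hantiq, hdiagq⟩
  have hxG := hx.map ιq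
  have hxy := sum_mul_antipode hΔMq hΔGq hεGq hS2q
  have hyx := sum_antipode_mul_generator hΔMq hΔGq hεGq hS1q
  have hS : ∀ (n : ℕ) (I J : Fin n → Fin N),
      Stq (ιq (wordProd xq I J)) = wordProdRev (fun i j => Stq (ιq (xq i j))) I J :=
    fun n => antipode_wordProd hΔMq hΔGq hεGq hS1q hS2q
  have he : ∀ i j, eq (xq i j) = if i = j then θ (ξ i i) else 0 := fun i j => by
    rw [heq]
    split_ifs with h
    · rw [h]
    · rw [hξdiag i j h, map_zero]
  have hlx := leftCoactHom_generator hΔMq hΔGq hπDq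
  have hly := map_inverse_generator (x := fun i j => ιq (xq i j)) hlx hxy hyx
  obtain ⟨m, a, ha⟩ := exists_polynomial_smul_eq hη (hθ.trans hX.symm) fun i => ξ i i
  have hV : IsOrbitSubmodule a (fun i j => ιq (xq i j)) (fun i j => Stq (ιq (xq i j)))
      (LinearMap.range (coorbit eq (adjBeta ΔMq ιq Stq))) := by
    refine ⟨one_mem_range_coorbit hΔMq hS, fun f hf i j => ?_, hyx, ?_, ?_, ?_⟩
    · simp only [(ha _).1, mul_smul, ← Finset.smul_sum]
      exact Submodule.smul_mem _ _ (sum_smul_mem_range_coorbit hΔMq hS hgenq he hf i j)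
    · rw [hX]
      exact hxG.sum_traceWeight hq hxy hyx
    · rw [hX]
      exact fun n => hxG.rtt_word hq
    · rw [hX]
      intro n i I J
      simp only [← hS, ← map_smul, ← map_add, hx.rtt_word hq]
  obtain ⟨P, hP, hPw⟩ := exists_coinvariant_projection hlx hly hfreeDq
  ext f
  constructor
  · rintro ⟨h, rfl⟩
    exact map_coorbit_eq_tmul hΔMq hS hgenq he hlx hly h
  · intro hf
    refine hV.mem_of_projection (P := P) (fun i j hij => ?_)
      (hxG.wordSpan_eq_top hq hq2 hxy hyx (by rw [← map_qdet]; exact hd1q) hgenGq) ?_ hPw (hP f hf)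
    · by_contra h
      refine hdist i j h ?_
      simpa only [(ha _).2] using hij
    · rintro _ ⟨h, rfl⟩
      exact hP _ (map_coorbit_eq_tmul hΔMq hS hgenq he hlx hly h)
end
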